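/- arXiv:math/0507180 — 2 statements merged into one kernel-verified Lean document; each statement's English description precedes it below -/
import Mathlib

section
/- Let α ≥ 0 and C0, C1, C2 > 0 be constants and let (a_n)_{n≥1} be a sequence of positive numbers. Let P be a distribution of (X,Y) on R^d × {0,1} satisfying the margin assumption MA(α, C0), and for each n let η̂_n be an estimator of the regression function η (a jointly measurable function of the sample (X_1,Y_1),…,(X_n,Y_n) and of x ∈ R^d) such that for every δ > 0 and for P_X-almost every x, P^{⊗n}(|η̂_n(x) − η(x)| ≥ δ) ≤ C1 exp(−C2 a_n δ²). Then there exists a constant C > 0 depending only on α, C0, C1 and C2 such that the plug-in classifier f̂_n = 1{η̂_n ≥ 1/2} satisfies E[R(f̂_n)] − R(f*) ≤ C a_n^{−(1+α)/2} for every n ≥ 1. -/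
open MeasureTheory Metric Set
open scoped ENNReal NNReal

noncomputable section

/-- Feature space: `ℝ^d` with the Euclidean norm. -/
abbrev Euc (d : ℕ) := EuclideanSpace ℝ (Fin d)

/-- A sample of size `n`: `n` points of `ℝ^d × {0,1}` (labels modelled by `Bool`). -/
abbrev Sample (d n : ℕ) := Fin n → Euc d × Bool

/-- Joint law of `(X,Y)` determined by the marginal `PX` and the regression
function `η(x) = P(Y = 1 | X = x)`. -/
def jointLaw {d : ℕ} (PX : Measure (Euc d)) (η : Euc d → ℝ) : Measure (Euc d × Bool) :=
  PX.bind fun x =>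
    ENNReal.ofReal (η x) • Measure.dirac (x, true) +
      ENNReal.ofReal (1 - η x) • Measure.dirac (x, false)

/-- Law `P^{⊗n}` of an i.i.d. sample of size `n`. -/
def sampleLaw {d : ℕ} (PX : Measure (Euc d)) (η : Euc d → ℝ) (n : ℕ) :
    Measure (Sample d n) :=
  Measure.pi fun _ => jointLaw PX η

/-- Misclassification risk `R(f) = P(Y ≠ f(X))` of a decision rule `f`. -/
def risk {d : ℕ} (PX : Measure (Euc d)) (η : Euc d → ℝ) (f : Euc d → Bool) : ℝ :=
  ∫ x, (if f x then 1 - η x else η x) ∂PX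

/-- The Bayes rule `f*(x) = 1{η(x) ≥ 1/2}`. -/
def bayes {d : ℕ} (η : Euc d → ℝ) : Euc d → Bool := fun x => decide ((1 : ℝ) / 2 ≤ η x)

/-- The plug-in rule `1{g ≥ 1/2}` associated with a function `g`. -/
def plugin {d : ℕ} (g : Euc d → ℝ) : Euc d → Bool := fun x => decide ((1 : ℝ) / 2 ≤ g x)

/-- Margin (low noise) assumption MA(α, C0):
`P_X(0 < |η(X) − 1/2| ≤ t) ≤ C0 t^α` for all `t > 0`. -/
def Margin {d : ℕ} (PX : Measure (Euc d)) (η : Euc d → ℝ) (α C0 : ℝ) : Prop :=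
  ∀ t : ℝ, 0 < t →
    PX {x | 0 < |η x - 1 / 2| ∧ |η x - 1 / 2| ≤ t} ≤ ENNReal.ofReal (C0 * t ^ α)

/-- Taylor polynomial of degree `N` of `g` at `x`, evaluated at `x'`. -/
def taylorPoly {d : ℕ} (g : Euc d → ℝ) (N : ℕ) (x x' : Euc d) : ℝ :=
  ∑ k ∈ Finset.range (N + 1), (k.factorial : ℝ)⁻¹ * iteratedFDeriv ℝ k g x (fun _ => x' - x)

/-- The Hölder class `Σ(β, L, ℝ^d)`: `g` is `⌊β⌋` times continuously differentiable
(`⌊β⌋` = largest integer strictly less than `β`, i.e. `⌈β⌉₊ - 1` for `β > 0`) and its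
Taylor polynomial of degree `⌊β⌋` approximates it to order `L‖x − x'‖^β`. -/
def HolderClass {d : ℕ} (β L : ℝ) (g : Euc d → ℝ) : Prop :=
  ContDiff ℝ (⌈β⌉₊ - 1 : ℕ) g ∧
    ∀ x x' : Euc d, |g x' - taylorPoly g (⌈β⌉₊ - 1) x x'| ≤ L * ‖x' - x‖ ^ β

/-- `(c0, r0)`-regularity of a set `A`:
`λ[A ∩ B(x,r)] ≥ c0 λ[B(x,r)]` for all `0 < r ≤ r0` and `x ∈ A`. -/
def Regular {d : ℕ} (c0 r0 : ℝ) (A : Set (Euc d)) : Prop :=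
  ∀ x ∈ A, ∀ r : ℝ, 0 < r → r ≤ r0 →
    ENNReal.ofReal c0 * volume (closedBall x r) ≤ volume (A ∩ closedBall x r)

/-- Strong density assumption with parameters `(c0, r0, μmin, μmax, K)`. -/
def StrongDensity {d : ℕ} (PX : Measure (Euc d)) (c0 r0 μmin μmax : ℝ)
    (K : Set (Euc d)) : Prop :=
  ∃ A : Set (Euc d), IsCompact A ∧ A ⊆ K ∧ Regular c0 r0 A ∧
    ∃ μ : Euc d → ℝ, Measurable μ ∧ (∀ x ∈ A, μmin ≤ μ x ∧ μ x ≤ μmax) ∧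
      (∀ x, x ∉ A → μ x = 0) ∧
      PX = volume.withDensity fun x => ENNReal.ofReal (μ x)

/-- Mild density assumption with parameters `(c0, r0, μmax, K)`. -/
def MildDensity {d : ℕ} (PX : Measure (Euc d)) (c0 r0 μmax : ℝ)
    (K : Set (Euc d)) : Prop :=
  ∃ A : Set (Euc d), IsCompact A ∧ A ⊆ K ∧ Regular c0 r0 A ∧
    ∃ μ : Euc d → ℝ, Measurable μ ∧ (∀ x ∈ A, 0 ≤ μ x ∧ μ x ≤ μmax) ∧
      (∀ x, x ∉ A → μ x = 0) ∧
      PX = volume.withDensity fun x => ENNReal.ofReal (μ x)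

/-- The class `P_Σ(α, C0, β, L, c0, r0, μmin, μmax, K)`, a distribution being encoded
by its marginal `PX` together with its regression function `η`. -/
def MemPS {d : ℕ} (α C0 β L c0 r0 μmin μmax : ℝ) (K : Set (Euc d))
    (PX : Measure (Euc d)) (η : Euc d → ℝ) : Prop :=
  IsProbabilityMeasure PX ∧ Measurable η ∧ (∀ x, η x ∈ Icc (0 : ℝ) 1) ∧
    Margin PX η α C0 ∧ HolderClass β L η ∧ StrongDensity PX c0 r0 μmin μmax K

/-- Topological support of a measure on `ℝ^d`. -/
def msupport {d : ℕ} (PX : Measure (Euc d)) : Set (Euc d) :=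
  {x | ∀ r : ℝ, 0 < r → 0 < PX (ball x r)}

/-- `f` hits the level `a` at `x0`. -/
def Hits {d : ℕ} (f : Euc d → ℝ) (a : ℝ) (x0 : Euc d) : Prop :=
  f x0 = a ∧ ∀ r : ℝ, 0 < r → ∃ x ∈ closedBall x0 r, f x ≠ a

/-- `f` crosses the level `a` at `x0`. -/
def Crosses {d : ℕ} (f : Euc d → ℝ) (a : ℝ) (x0 : Euc d) : Prop :=
  ∀ r : ℝ, 0 < r → (∃ x ∈ closedBall x0 r, f x < a) ∧ ∃ x ∈ closedBall x0 r, a < f x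

/-- Expected excess risk `E[R(f̂_n)] − R(f*)` of a plug-in classifier built from the
estimator `hatη` of the regression function. -/
def expExcess {d : ℕ} (PX : Measure (Euc d)) (η : Euc d → ℝ) {n : ℕ}
    (hatη : Sample d n → Euc d → ℝ) : ℝ :=
  (∫ ω, risk PX η (plugin (hatη ω)) ∂sampleLaw PX η n) - risk PX η (bayes η)

/-- Expected excess risk `E[R(f̂_n)] − R(f*)` of a (general) classifier. -/
def expExcessRule {d : ℕ} (PX : Measure (Euc d)) (η : Euc d → ℝ) {n : ℕ}
    (fhat : Sample d n → Euc d → Bool) : ℝ :=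
  (∫ ω, risk PX η (fhat ω) ∂sampleLaw PX η n) - risk PX η (bayes η)

/-- Empirical misclassification risk of the plug-in rule `1{g ≥ 1/2}` on a sample. -/
def empRisk {d n : ℕ} (ω : Sample d n) (g : Euc d → ℝ) : ℝ :=
  (n : ℝ)⁻¹ * ∑ i : Fin n, if plugin g (ω i).1 ≠ (ω i).2 then (1 : ℝ) else 0

lemma aux_summable (α C2 : ℝ) (hC2 : 0 < C2) :
    Summable fun j : ℕ => ((2:ℝ) ^ (j+1)) ^ (1+α) * Real.exp (-C2 * 4 ^ j) := by
  apply summable_of_ratio_test_tendsto_lt_one (l := 0) one_pos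
  · exact Filter.Eventually.of_forall fun j => by positivity
  · have h : ∀ j : ℕ, ‖((2:ℝ) ^ (j+1+1)) ^ (1+α) * Real.exp (-C2 * 4 ^ (j+1))‖ /
        ‖((2:ℝ) ^ (j+1)) ^ (1+α) * Real.exp (-C2 * 4 ^ j)‖
        = (2:ℝ) ^ (1+α) * Real.exp (-(3 * C2 * 4 ^ j)) := by
      intro j
      rw [Real.norm_of_nonneg (by positivity), Real.norm_of_nonneg (by positivity),
        pow_succ (2:ℝ) (j+1), Real.mul_rpow (by positivity) (by norm_num),
        div_eq_iff (by positivity)]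
      have : Real.exp (-C2 * 4 ^ (j+1)) =
          Real.exp (-(3 * C2 * 4 ^ j)) * Real.exp (-C2 * 4 ^ j) := by
        rw [← Real.exp_add]; congr 1; ring
      rw [this]; ring
    simp_rw [h]
    have h2 : Filter.Tendsto (fun j : ℕ => 3 * C2 * (4:ℝ) ^ j) Filter.atTop Filter.atTop :=
      (tendsto_pow_atTop_atTop_of_one_lt (by norm_num)).const_mul_atTop (by positivity)
    simpa using (Real.tendsto_exp_neg_atTop_nhds_zero.comp h2).const_mul ((2:ℝ) ^ (1+α))

lemma aux_prob {d : ℕ} (PX : Measure (Euc d)) [IsProbabilityMeasure PX] (η : Euc d → ℝ)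
    (hη : Measurable η) (h01 : ∀ x, η x ∈ Icc (0 : ℝ) 1) :
    IsProbabilityMeasure (jointLaw PX η) := by
  have hm : Measurable fun x => ENNReal.ofReal (η x) • Measure.dirac (x, true) +
      ENNReal.ofReal (1 - η x) • Measure.dirac (x, false) := by
    refine Measure.measurable_of_measurable_coe _ fun s hs => ?_
    simp only [Measure.coe_add, Measure.coe_smul, Pi.add_apply, Pi.smul_apply, smul_eq_mul,
      Measure.dirac_apply' _ hs]
    have h1 : ∀ b : Bool, Measurable fun x : Euc d => s.indicator (1 : Euc d × Bool → ℝ≥0∞) (x, b) :=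
      fun b => (measurable_one.indicator hs).comp measurable_prodMk_right
    exact (hη.ennreal_ofReal.mul (h1 true)).add
      ((measurable_const.sub hη).ennreal_ofReal.mul (h1 false))
  constructor
  rw [jointLaw, Measure.bind_apply MeasurableSet.univ hm.aemeasurable]
  have : ∀ x, (ENNReal.ofReal (η x) • Measure.dirac (x, true) +
      ENNReal.ofReal (1 - η x) • Measure.dirac (x, false)) (univ : Set (Euc d × Bool)) = 1 := by
    intro x
    simp only [Measure.coe_add, Measure.coe_smul, Pi.add_apply, Pi.smul_apply, smul_eq_mul,
      measure_univ, mul_one]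
    rw [← ENNReal.ofReal_add (h01 x).1 (by linarith [(h01 x).2])]
    simp
  simp [this]

/-- pointwise regret -/
def regret (e g : ℝ) : ℝ :=
  (if decide ((1:ℝ)/2 ≤ g) = true then 1 - e else e) -
    (if decide ((1:ℝ)/2 ≤ e) = true then 1 - e else e)

lemma regret_nonneg (e g : ℝ) : 0 ≤ regret e g := by
  unfold regret
  simp only [decide_eq_true_eq]
  split_ifs <;> linarith

lemma regret_le (e g : ℝ) : regret e g ≤ 2 * |e - 1/2| := by
  unfold regret
  simp only [decide_eq_true_eq]
  have := le_abs_self (e - 1/2)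
  have := neg_abs_le (e - 1/2)
  split_ifs <;> linarith

lemma regret_eq_zero (e g : ℝ) (h : |g - e| < |e - 1/2|) : regret e g = 0 := by
  unfold regret
  simp only [decide_eq_true_eq]
  split_ifs with h1 h2 h2
  · ring
  · rw [abs_of_nonpos (by linarith : e - 1/2 ≤ 0)] at h
    have := (abs_lt.1 h).2
    linarith
  · rw [abs_of_nonneg (by linarith : 0 ≤ e - 1/2)] at h
    have := (abs_lt.1 h).1
    linarith
  · ring

lemma aux_expExcess {d n : ℕ} (PX : Measure (Euc d)) [IsProbabilityMeasure PX] (η : Euc d → ℝ)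
    (hη : Measurable η) (h01 : ∀ x, η x ∈ Icc (0 : ℝ) 1) (g : Sample d n → Euc d → ℝ)
    (hg : Measurable (Function.uncurry g)) :
    expExcess PX η g =
      (∫⁻ x, ∫⁻ ω, ENNReal.ofReal (regret (η x) (g ω x)) ∂sampleLaw PX η n ∂PX).toReal := by
  have := aux_prob PX η hη h01
  have hQ : IsProbabilityMeasure (sampleLaw PX η n) := by
    unfold sampleLaw; infer_instance
  set Q := sampleLaw PX η n with hQdef
  have hη2 : Measurable fun p : Sample d n × Euc d => η p.2 := hη.comp measurable_snd
  have m1 : Measurable fun p : Sample d n × Euc d =>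
      (if plugin (g p.1) p.2 = true then 1 - η p.2 else η p.2) := by
    refine Measurable.ite ?_ (measurable_const.sub hη2) hη2
    simp only [plugin, decide_eq_true_eq]
    exact measurableSet_le measurable_const hg
  have m2 : Measurable fun x : Euc d => (if bayes η x = true then 1 - η x else η x) := by
    refine Measurable.ite ?_ (measurable_const.sub hη) hη
    simp only [bayes, decide_eq_true_eq]
    exact measurableSet_le measurable_const hη
  have b : ∀ (x : Euc d) (c : Bool), ‖(if c = true then 1 - η x else η x)‖ ≤ 1 := by
    intro x c
    have := h01 x
    rw [Real.norm_eq_abs, abs_le]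
    constructor <;> split_ifs <;> linarith [this.1, this.2]
  have i1 : Integrable (fun p : Sample d n × Euc d =>
      (if plugin (g p.1) p.2 = true then 1 - η p.2 else η p.2)) (Q.prod PX) :=
    Integrable.of_bound m1.aestronglyMeasurable 1 (Filter.Eventually.of_forall fun p => b _ _)
  have i2 : Integrable (fun p : Sample d n × Euc d =>
      (if bayes η p.2 = true then 1 - η p.2 else η p.2)) (Q.prod PX) :=
    Integrable.of_bound (m2.comp measurable_snd).aestronglyMeasurable 1
      (Filter.Eventually.of_forall fun p => b _ _)
  have e1 : expExcess PX η g = ∫ p, regret (η p.2) (g p.1 p.2) ∂(Q.prod PX) := by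
    have h3 := integral_sub i1 i2
    change _ = ∫ p : Sample d n × Euc d,
      ((if plugin (g p.1) p.2 = true then 1 - η p.2 else η p.2) -
        (if bayes η p.2 = true then 1 - η p.2 else η p.2)) ∂(Q.prod PX)
    rw [h3, integral_prod _ i1, integral_prod _ i2]
    simp [expExcess, risk, hQdef]
  have mr : Measurable fun p : Sample d n × Euc d => regret (η p.2) (g p.1 p.2) :=
    m1.sub (m2.comp measurable_snd)
  rw [e1, integral_eq_lintegral_of_nonneg_ae
    (Filter.Eventually.of_forall fun p => regret_nonneg _ _) mr.aestronglyMeasurable,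
    lintegral_prod_symm _ mr.ennreal_ofReal.aemeasurable]

lemma aux_inner {Ω : Type*} [MeasurableSpace Ω] (Q : Measure Ω) (e : ℝ) (g : Ω → ℝ)
    (hg : Measurable g) (t : ℝ) (ht : t ≤ |e - 1/2|) :
    ∫⁻ ω, ENNReal.ofReal (regret e (g ω)) ∂Q ≤
      ENNReal.ofReal (2 * |e - 1/2|) * Q {ω | t ≤ |g ω - e|} := by
  have hs : MeasurableSet {ω | t ≤ |g ω - e|} :=
    measurableSet_le measurable_const (by fun_prop)
  rw [← lintegral_indicator_const hs]
  refine lintegral_mono fun ω => ?_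
  by_cases h : t ≤ |g ω - e|
  · rw [indicator_of_mem (by exact h)]
    exact ENNReal.ofReal_le_ofReal (regret_le _ _)
  · rw [regret_eq_zero _ _ (lt_of_lt_of_le (not_le.1 h) ht)]
    simp

lemma aux_main {d : ℕ} {Ω : Type*} [MeasurableSpace Ω] (Q : Measure Ω) [IsProbabilityMeasure Q]
    (PX : Measure (Euc d)) (η : Euc d → ℝ) (hη : Measurable η) (α C0 C1 C2 δ : ℝ)
    (hC0 : 0 < C0) (hC1 : 0 < C1) (hC2 : 0 < C2) (hδ : 0 < δ)
    (hM : Margin PX η α C0) (g : Ω → Euc d → ℝ) (hg : ∀ x, Measurable fun ω => g ω x)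
    (hdev : ∀ j : ℕ, ∀ᵐ x ∂PX, Q {ω | 2 ^ j * δ ≤ |g ω x - η x|} ≤
      ENNReal.ofReal (C1 * Real.exp (-C2 * 4 ^ j))) :
    ∫⁻ x, ∫⁻ ω, ENNReal.ofReal (regret (η x) (g ω x)) ∂Q ∂PX ≤
      ENNReal.ofReal ((2 * C0 + 2 * C0 * C1 *
        ∑' j : ℕ, ((2:ℝ) ^ (j+1)) ^ (1+α) * Real.exp (-C2 * 4 ^ j)) * δ ^ (1+α)) := by
  let T : ℝ → Set (Euc d) := fun t => {x | 0 < |η x - 1 / 2| ∧ |η x - 1 / 2| ≤ t}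
  have hmabs : Measurable fun x => |η x - 1 / 2| := by fun_prop
  have hT : ∀ t, MeasurableSet (T t) := fun t =>
    (measurableSet_lt measurable_const hmabs).inter (measurableSet_le hmabs measurable_const)
  let c : ℕ → ℝ := fun j => 2 * (2 ^ (j+1) * δ) * (C1 * Real.exp (-C2 * 4 ^ j))
  have hc : ∀ j, 0 ≤ c j := fun j => by positivity
  have key : ∀ᵐ x ∂PX, ∫⁻ ω, ENNReal.ofReal (regret (η x) (g ω x)) ∂Q ≤
      (T δ).indicator (fun _ => ENNReal.ofReal (2 * δ)) x +
      ∑' j : ℕ, (T (2 ^ (j+1) * δ)).indicator (fun _ => ENNReal.ofReal (c j)) x := by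
    filter_upwards [ae_all_iff.2 hdev] with x hx
    rcases (abs_nonneg (η x - 1/2)).eq_or_lt with h0 | h0
    · refine le_trans (aux_inner Q (η x) _ (hg x) _ le_rfl) ?_
      rw [← h0]; simp
    rcases le_or_gt (|η x - 1/2|) δ with h1 | h1
    · refine le_trans (aux_inner Q (η x) _ (hg x) _ le_rfl) (le_trans ?_ le_self_add)
      rw [indicator_of_mem (show x ∈ T δ from ⟨h0, h1⟩)]
      calc _ ≤ ENNReal.ofReal (2 * |η x - 1/2|) * 1 := by gcongr; exact prob_le_one
        _ ≤ _ := by rw [mul_one]; gcongr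
    · obtain ⟨j, hj1, hj2⟩ := exists_nat_pow_near (x := |η x - 1/2| / δ) (y := 2)
        ((one_le_div hδ).2 h1.le) one_lt_two
      rw [le_div_iff₀ hδ] at hj1
      rw [div_lt_iff₀ hδ] at hj2
      refine le_trans (aux_inner Q (η x) _ (hg x) _ hj1) (le_trans ?_ le_add_self)
      refine le_trans ?_ (ENNReal.le_tsum j)
      rw [indicator_of_mem (show x ∈ T (2 ^ (j+1) * δ) from ⟨h0, hj2.le⟩)]
      calc _ ≤ ENNReal.ofReal (2 * (2 ^ (j+1) * δ)) *
              ENNReal.ofReal (C1 * Real.exp (-C2 * 4 ^ j)) := by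
            gcongr
            exact hx j
        _ = _ := by rw [← ENNReal.ofReal_mul (by positivity)]
  refine le_trans (lintegral_mono_ae key) ?_
  rw [lintegral_add_left (measurable_const.indicator (hT _)),
    lintegral_tsum (fun j => (measurable_const.indicator (hT _)).aemeasurable)]
  simp_rw [lintegral_indicator_const (hT _)]
  have hsum := aux_summable α C2 hC2
  have hpow : δ * δ ^ α = δ ^ (1+α) := by
    rw [Real.rpow_add hδ, Real.rpow_one]
  have t0 : ENNReal.ofReal (2 * δ) * PX (T δ) ≤ ENNReal.ofReal (2 * C0 * δ ^ (1+α)) := by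
    refine le_trans (mul_le_mul_right (hM δ hδ) _) ?_
    rw [← ENNReal.ofReal_mul (by positivity), ← hpow]
    apply le_of_eq; congr 1; ring
  have tj : ∀ j : ℕ, ENNReal.ofReal (c j) * PX (T (2 ^ (j+1) * δ)) ≤
      ENNReal.ofReal (2 * C0 * C1 * δ ^ (1+α) *
        (((2:ℝ) ^ (j+1)) ^ (1+α) * Real.exp (-C2 * 4 ^ j))) := by
    intro j
    refine le_trans (mul_le_mul_right (hM _ (by positivity)) _) ?_
    rw [← ENNReal.ofReal_mul (hc j), ← hpow, Real.mul_rpow (by positivity) hδ.le,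
      Real.rpow_add (by positivity), Real.rpow_one]
    apply le_of_eq; congr 1; simp only [c]; ring
  refine le_trans (add_le_add t0 (ENNReal.tsum_le_tsum tj)) ?_
  rw [← ENNReal.ofReal_tsum_of_nonneg (fun j => by positivity) (hsum.mul_left _), tsum_mul_left,
    ← ENNReal.ofReal_add (by positivity)
      (mul_nonneg (by positivity) (tsum_nonneg fun j => by positivity))]
  apply le_of_eq; congr 1; ring

/-- Theorem 3.1 of Audibert–Tsybakov. Under the margin assumption
MA(α, C0), if an estimator of the regression function satisfies an exponential
deviation inequality with rate `a_n`, then the corresponding plug-in classifier has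
excess risk at most `C a_n^{-(1+α)/2}`, with `C` depending only on `α, C0, C1, C2`. -/
theorem stmt0 (α C0 C1 C2 : ℝ) (hα : 0 ≤ α) (hC0 : 0 < C0) (hC1 : 0 < C1) (hC2 : 0 < C2) :
    ∃ C : ℝ, 0 < C ∧
      ∀ (d : ℕ) (PX : Measure (Euc d)) (η : Euc d → ℝ) (a : ℕ → ℝ)
        (hatη : (n : ℕ) → Sample d n → Euc d → ℝ),
        IsProbabilityMeasure PX →
        Measurable η → (∀ x, η x ∈ Icc (0 : ℝ) 1) →
        Margin PX η α C0 →
        (∀ n, 1 ≤ n → 0 < a n) →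
        (∀ n, 1 ≤ n → Measurable (Function.uncurry (hatη n))) →
        (∀ n, 1 ≤ n → ∀ δ : ℝ, 0 < δ →
          ∀ᵐ x ∂PX,
            sampleLaw PX η n {ω | δ ≤ |hatη n ω x - η x|} ≤
              ENNReal.ofReal (C1 * Real.exp (-C2 * a n * δ ^ 2))) →
        ∀ n, 1 ≤ n → expExcess PX η (hatη n) ≤ C * a n ^ (-(1 + α) / 2) := by
  have hS : 0 ≤ ∑' j : ℕ, ((2:ℝ) ^ (j+1)) ^ (1+α) * Real.exp (-C2 * 4 ^ j) :=
    tsum_nonneg fun j => by positivity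
  refine ⟨2 * C0 + 2 * C0 * C1 *
    ∑' j : ℕ, ((2:ℝ) ^ (j+1)) ^ (1+α) * Real.exp (-C2 * 4 ^ j), by positivity, ?_⟩
  intro d PX η a hatη hP hη h01 hM ha hmeas hdev n hn
  have hJ := aux_prob PX η hη h01
  have hQ : IsProbabilityMeasure (sampleLaw PX η n) := by
    unfold sampleLaw; infer_instance
  have han := ha n hn
  have hδ : 0 < a n ^ (-(1:ℝ)/2) := by positivity
  have hδ2 : a n * (a n ^ (-(1:ℝ)/2)) ^ 2 = 1 := by
    rw [← Real.rpow_natCast, ← Real.rpow_mul han.le]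
    norm_num
    rw [Real.rpow_neg_one, mul_inv_cancel₀ han.ne']
  have hδα : (a n ^ (-(1:ℝ)/2)) ^ (1+α) = a n ^ (-(1 + α) / 2) := by
    rw [← Real.rpow_mul han.le]; congr 1; ring
  rw [aux_expExcess PX η hη h01 _ (hmeas n hn), ← hδα]
  refine ENNReal.toReal_le_of_le_ofReal (by positivity) ?_
  refine aux_main _ PX η hη α C0 C1 C2 _ hC0 hC1 hC2 hδ hM (hatη n)
    (fun x => (hmeas n hn).comp measurable_prodMk_right) fun j => ?_
  have h := hdev n hn (2 ^ j * a n ^ (-(1:ℝ)/2)) (by positivity)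
  have e : -C2 * a n * (2 ^ j * a n ^ (-(1:ℝ)/2)) ^ 2 = -C2 * 4 ^ j := by
    have h4 : ((2:ℝ) ^ j) ^ 2 = 4 ^ j := by
      rw [← pow_mul, mul_comm, pow_mul]; norm_num
    calc _ = -C2 * ((2:ℝ) ^ j) ^ 2 * (a n * (a n ^ (-(1:ℝ)/2)) ^ 2) := by ring
      _ = _ := by rw [hδ2, h4, mul_one]
  rwa [e] at h

end
end

section
/- Let d ≥ 1 be an integer, let β, L, c0, r0 > 0, 0 < μ_min ≤ μ_max < ∞ and let C ⊂ R^d be compact. Then there exist constants C1, C2 > 0 (depending only on β, d, L, c0, r0, μ_min, μ_max) and, for each n ≥ 1, an estimator η̂*_n (a jointly measurable function of the sample (X_1,Y_1),…,(X_n,Y_n) and of x ∈ R^d, with values in [0,1]) such that for every distribution P of (X,Y) on R^d × {0,1} whose regression function η belongs to the Hölder class Σ(β, L, R^d) and whose marginal P_X satisfies the strong density assumption with parameters (c0, r0, μ_min, μ_max, C), for every δ > 0 and for P_X-almost every x: P^{⊗n}(|η̂*_n(x) − η(x)| ≥ δ) ≤ C1 exp(−C2 n^{2β/(2β+d)} δ²).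 -/
open MeasureTheory Metric Set
open scoped ENNReal NNReal

noncomputable section

open Classical in
lemma poly1_finite {l : ℕ} (c : Fin (l+1) → ℝ) (k : Fin (l+1)) (hk : c k ≠ 0) :
    {t : ℝ | ∑ j, c j * t ^ (j : ℕ) = 0}.Finite := by
  let p : Polynomial ℝ := ∑ j : Fin (l+1), Polynomial.C (c j) * Polynomial.X ^ (j : ℕ)
  have hp : p ≠ 0 := by
    intro h
    have : p.coeff k = c k := by
      simp only [p, Polynomial.finsetSum_coeff, Polynomial.coeff_C_mul_X_pow]
      rw [Finset.sum_eq_single k]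
      · simp
      · intro b _ hb
        rw [if_neg]
        intro h; exact hb (Fin.ext h.symm)
      · simp
    rw [h] at this
    simp at this
    exact hk this.symm
  refine (Polynomial.rootSet_finite p ℝ).subset ?_
  intro t ht
  rw [Polynomial.mem_rootSet]
  refine ⟨hp, ?_⟩
  simpa [p, Polynomial.eval_finsetSum] using ht

/-- monomials -/
def monom {d l : ℕ} (a : Fin d → Fin (l+1)) (u : Fin d → ℝ) : ℝ := ∏ i, u i ^ (a i : ℕ)

lemma measurable_monom' {d l : ℕ} (a : Fin d → Fin (l+1)) : Measurable (monom a) := by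
  unfold monom
  fun_prop

lemma poly_null (l : ℕ) : ∀ (d : ℕ) (v : (Fin d → Fin (l+1)) → ℝ), v ≠ 0 →
    volume {u : Fin d → ℝ | ∑ a, v a * monom a u = 0} = 0 := by
  intro d
  induction d with
  | zero =>
    intro v hv
    have : {u : Fin 0 → ℝ | ∑ a, v a * monom a u = 0} = ∅ := by
      ext u
      simp only [mem_ofPred_eq, mem_empty_iff_false, iff_false]
      intro h
      apply hv
      funext a
      rw [Fintype.sum_subsingleton _ a] at h
      simpa [monom] using h
    rw [this]; simp
  | succ d ih =>
    intro v hv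
    have hex : ∃ k : Fin (l+1), (fun a' : Fin d → Fin (l+1) => v (Fin.cons k a')) ≠ 0 := by
      by_contra hcon
      push Not at hcon
      apply hv
      funext a
      have := congrFun (hcon (a 0)) (Fin.tail a)
      simpa using this
    obtain ⟨k, hk⟩ := hex
    have h0 := ih _ hk
    have hmp := volume_preserving_piFinSuccAbove (fun _ : Fin (d+1) => ℝ) 0
    let S : Set (ℝ × (Fin d → ℝ)) :=
      {q | ∑ j : Fin (l+1), (∑ a', v (Fin.cons j a') * monom a' q.2) * q.1 ^ (j : ℕ) = 0}
    have hS : MeasurableSet S := by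
      have : Measurable fun q : ℝ × (Fin d → ℝ) =>
          ∑ j : Fin (l+1), (∑ a', v (Fin.cons j a') * monom a' q.2) * q.1 ^ (j : ℕ) := by
        refine Finset.measurable_sum _ fun j _ => ?_
        refine Measurable.mul ?_ (by fun_prop)
        refine Finset.measurable_sum _ fun a _ => ?_
        exact ((measurable_monom' a).comp measurable_snd).const_mul _
      exact this (measurableSet_singleton 0)
    have hpre : {u : Fin (d+1) → ℝ | ∑ a, v a * monom a u = 0} =
        (MeasurableEquiv.piFinSuccAbove (fun _ : Fin (d+1) => ℝ) 0) ⁻¹' S := by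
      ext u
      simp only [mem_ofPred_eq, mem_preimage, S]
      have : ∑ a, v a * monom a u = ∑ j : Fin (l+1), (∑ a' : Fin d → Fin (l+1),
          v (Fin.cons j a') * monom a' (fun i => u i.succ)) * (u 0) ^ (j : ℕ) := by
        rw [← (Fin.consEquiv (fun _ : Fin (d+1) => Fin (l+1))).sum_comp, Fintype.sum_prod_type]
        refine Finset.sum_congr rfl fun j _ => ?_
        rw [Finset.sum_mul]
        refine Finset.sum_congr rfl fun a _ => ?_
        simp [monom, Fin.prod_univ_succ, Fin.consEquiv]
        ring
      rw [this]
      rfl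
    rw [hpre, hmp.measure_preimage hS.nullMeasurableSet]
    rw [Measure.volume_eq_prod, Measure.prod_apply_symm hS]
    rw [lintegral_eq_zero_iff (measurable_measure_prodMk_right hS)]
    have h1 : ∀ᵐ u' : Fin d → ℝ, ∑ a', v (Fin.cons k a') * monom a' u' ≠ 0 := by
      rw [ae_iff]
      simpa using h0
    filter_upwards [h1] with u' hu'
    have := (poly1_finite (fun j => ∑ a', v (Fin.cons j a') * monom a' u') k hu').measure_zero volume
    exact this

/-- monomials on Euclidean space -/
def phi {d l : ℕ} (a : Fin d → Fin (l+1)) (u : Euc d) : ℝ := monom a (fun i => u i)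

/-- polynomial with coefficients `v` -/
def pol {d l : ℕ} (v : (Fin d → Fin (l+1)) → ℝ) (u : Euc d) : ℝ := ∑ a, v a * phi a u

lemma continuous_phi {d l : ℕ} (a : Fin d → Fin (l+1)) : Continuous (phi a : Euc d → ℝ) := by
  unfold phi monom
  fun_prop

lemma continuous_pol {d l : ℕ} (v : (Fin d → Fin (l+1)) → ℝ) : Continuous (pol v : Euc d → ℝ) := by
  unfold pol
  exact continuous_finsetSum _ fun a _ => (continuous_phi a).const_mul _

lemma abs_phi_le {d l : ℕ} (a : Fin d → Fin (l+1)) (u : Euc d) (hu : ‖u‖ ≤ 1) : |phi a u| ≤ 1 := by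
  unfold phi monom
  rw [Finset.abs_prod]
  refine Finset.prod_le_one (fun i _ => abs_nonneg _) fun i _ => ?_
  rw [abs_pow]
  refine pow_le_one₀ (abs_nonneg _) ?_
  have := EuclideanSpace.norm_eq u
  have h2 := PiLp.norm_apply_le u i
  rw [Real.norm_eq_abs] at h2
  linarith

lemma phi_zero {d l : ℕ} (a : Fin d → Fin (l+1)) (ha : a ≠ 0) : phi a (0 : Euc d) = 0 := by
  unfold phi monom
  obtain ⟨i, hi⟩ := Function.ne_iff.1 ha
  refine Finset.prod_eq_zero (Finset.mem_univ i) ?_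
  have : (a i : ℕ) ≠ 0 := by
    intro h; exact hi (Fin.ext h)
  simp [this]

lemma pol_zero {d l : ℕ} (v : (Fin d → Fin (l+1)) → ℝ) : pol v (0 : Euc d) = v 0 := by
  unfold pol
  rw [Finset.sum_eq_single 0]
  · simp [phi, monom]
  · intro b _ hb; rw [phi_zero b hb, mul_zero]
  · simp

lemma pol_null {d l : ℕ} (v : (Fin d → Fin (l+1)) → ℝ) (hv : v ≠ 0) :
    volume {u : Euc d | pol v u = 0} = 0 := by
  have h := poly_null l d v hv
  have hmp := PiLp.volume_preserving_ofLp (Fin d)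
  have hS : MeasurableSet {u : Fin d → ℝ | ∑ a, v a * monom a u = 0} := by
    have : Measurable fun u : Fin d → ℝ => ∑ a, v a * monom a u :=
      Finset.measurable_sum _ fun a _ => (measurable_monom' a).const_mul _
    exact this (measurableSet_singleton 0)
  rw [← hmp.measure_preimage hS.nullMeasurableSet] at h
  exact h

lemma level_unif (d l : ℕ) (c : ℝ≥0∞) (hc : 0 < c) : ∃ ε : ℝ, 0 < ε ∧
    ∀ v : (Fin d → Fin (l+1)) → ℝ, ∑ a, v a ^ 2 = 1 →
      volume {u : Euc d | u ∈ closedBall (0 : Euc d) 1 ∧ |pol v u| ≤ ε} ≤ c := by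
  have hcomp : IsCompact {v : (Fin d → Fin (l+1)) → ℝ | ∑ a, v a ^ 2 = 1} := by
    refine Metric.isCompact_of_isClosed_isBounded ?_ ?_
    · exact isClosed_eq (by fun_prop) continuous_const
    · refine (Metric.isBounded_closedBall (x := (0 : (Fin d → Fin (l+1)) → ℝ)) (r := 1)).subset ?_
      intro v hv
      have hv' : ∑ a, v a ^ 2 = 1 := hv
      rw [mem_closedBall_zero_iff, pi_norm_le_iff_of_nonneg zero_le_one]
      intro a
      have : v a ^ 2 ≤ 1 := by
        rw [← hv']
        exact Finset.single_le_sum (f := fun a => v a ^ 2) (fun i _ => sq_nonneg _) (Finset.mem_univ a)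
      rw [Real.norm_eq_abs]
      exact abs_le_one_iff_mul_self_le_one.2 (by nlinarith)
  have key := hcomp.induction_on (p := fun s => ∃ ε : ℝ, 0 < ε ∧ ∀ v ∈ s,
      volume {u : Euc d | u ∈ closedBall (0 : Euc d) 1 ∧ |pol v u| ≤ ε} ≤ c) ?_ ?_ ?_ ?_
  · exact key
  · exact ⟨1, one_pos, by simp⟩
  · rintro s t hst ⟨ε, h, h'⟩
    exact ⟨ε, h, fun v hv => h' v (hst hv)⟩
  · rintro s t ⟨ε, h, h'⟩ ⟨ε2, h2, h2'⟩
    refine ⟨min ε ε2, lt_min h h2, ?_⟩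
    rintro v (hv | hv)
    · refine (measure_mono ?_).trans (h' v hv)
      rintro u ⟨hu, hu'⟩
      exact ⟨hu, hu'.trans (min_le_left _ _)⟩
    · refine (measure_mono ?_).trans (h2' v hv)
      rintro u ⟨hu, hu'⟩
      exact ⟨hu, hu'.trans (min_le_right _ _)⟩
  · intro v hv
    have hv' : ∑ a, v a ^ 2 = 1 := hv
    have hv0 : v ≠ 0 := by rintro rfl; simp at hv'
    let S : ℕ → Set (Euc d) := fun k =>
      {u : Euc d | u ∈ closedBall (0 : Euc d) 1 ∧ |pol v u| ≤ 1 / ((k : ℝ) + 1)}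
    have hSm : ∀ k, MeasurableSet (S k) := fun k =>
      measurableSet_closedBall.inter
        (measurableSet_le (continuous_pol v).abs.measurable measurable_const)
    have hanti : Antitone S := by
      rintro i j hij u ⟨hu, hu'⟩
      refine ⟨hu, hu'.trans ?_⟩
      exact one_div_le_one_div_of_le (by positivity) (by gcongr)
    have hlim := tendsto_measure_iInter_atTop (μ := (volume : Measure (Euc d)))
      (fun k => (hSm k).nullMeasurableSet) hanti ⟨0, ne_top_of_le_ne_top
        (measure_closedBall_lt_top (x := (0 : Euc d)) (r := 1)).ne (measure_mono fun u hu => hu.1)⟩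
    have hz : volume (⋂ k, S k) = 0 := by
      refine measure_mono_null ?_ (pol_null v hv0)
      intro u hu
      have hu' : ∀ k : ℕ, |pol v u| ≤ 1 / ((k : ℝ) + 1) := fun k => (mem_iInter.1 hu k).2
      have : |pol v u| ≤ 0 := ge_of_tendsto' tendsto_one_div_add_atTop_nhds_zero_nat hu'
      exact abs_nonpos_iff.1 this
    rw [hz] at hlim
    obtain ⟨k, hk⟩ := (hlim.eventually (gt_mem_nhds hc)).exists
    set ε : ℝ := 1 / ((k : ℝ) + 1) with hε
    have hεp : 0 < ε := by positivity
    set p : ℝ := (Fintype.card (Fin d → Fin (l+1)) : ℝ) with hp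
    have hpp : 0 < p := by
      rw [hp]; exact_mod_cast Fintype.card_pos
    refine ⟨ball v (ε / (2 * p)), mem_nhdsWithin_of_mem_nhds (ball_mem_nhds _ (by positivity)),
      ε / 2, by positivity, ?_⟩
    intro w hw
    refine (measure_mono ?_).trans hk.le
    rintro u ⟨hu, hu'⟩
    refine ⟨hu, ?_⟩
    have hu1 : ‖u‖ ≤ 1 := by simpa using hu
    have hdiff : |pol v u - pol w u| ≤ ε / 2 := by
      unfold pol
      rw [← Finset.sum_sub_distrib]
      refine (Finset.abs_sum_le_sum_abs _ _).trans ?_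
      have : ∀ a ∈ (Finset.univ : Finset (Fin d → Fin (l+1))),
          |v a * phi a u - w a * phi a u| ≤ ε / (2 * p) := by
        intro a _
        rw [← sub_mul, abs_mul]
        have h1 : |v a - w a| ≤ ε / (2 * p) := by
          have := dist_le_pi_dist w v a
          rw [Real.dist_eq, abs_sub_comm] at this
          exact this.trans (mem_ball.1 hw).le
        have h2 := abs_phi_le a u hu1
        have h3 : 0 ≤ ε / (2 * p) := by positivity
        nlinarith [abs_nonneg (v a - w a), abs_nonneg (phi a u)]
      refine (Finset.sum_le_card_nsmul _ _ _ this).trans ?_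
      rw [nsmul_eq_mul, Finset.card_univ, ← hp]
      apply le_of_eq
      field_simp
    have := abs_sub_abs_le_abs_sub (pol v u) (pol w u)
    linarith

lemma coer (d l : ℕ) (c0 μmin : ℝ) (hc0 : 0 < c0) (hμmin : 0 < μmin) : ∃ lam : ℝ, 0 < lam ∧
    ∀ (A : Set (Euc d)) (PX : Measure (Euc d)) (h : ℝ) (x : Euc d), IsProbabilityMeasure PX →
      0 < h → (∀ S, MeasurableSet S → ENNReal.ofReal μmin * volume (A ∩ S) ≤ PX S) →
      ENNReal.ofReal c0 * volume (closedBall x h) ≤ volume (A ∩ closedBall x h) →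
      ∀ v : (Fin d → Fin (l+1)) → ℝ, lam * h ^ d * ∑ a, v a ^ 2 ≤
        ∫ u, (closedBall x h).indicator (fun u => pol v (h⁻¹ • (u - x)) ^ 2) u ∂PX := by
  set V0 : ℝ := volume.real (closedBall (0 : Euc d) 1) with hV0
  have hV0p : 0 < V0 := by
    rw [hV0, Measure.real]
    exact ENNReal.toReal_pos (measure_closedBall_pos _ _ one_pos).ne' measure_closedBall_lt_top.ne
  obtain ⟨ε, hε, hlev⟩ := level_unif d l (ENNReal.ofReal (c0 * V0 / 2))
    (ENNReal.ofReal_pos.2 (by positivity))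
  refine ⟨ε ^ 2 * (μmin * (c0 * V0 / 2)), by positivity, ?_⟩
  intro A PX h x hP hh hPX hA
  have hbound : ∀ v : (Fin d → Fin (l+1)) → ℝ, Integrable
      ((closedBall x h).indicator (fun u => pol v (h⁻¹ • (u - x)) ^ 2)) PX := by
    intro v
    have hcont : Continuous fun u => pol v (h⁻¹ • (u - x)) ^ 2 :=
      ((continuous_pol v).comp (by fun_prop)).pow 2
    obtain ⟨M, hM⟩ := (isCompact_closedBall x h).exists_bound_of_continuousOn hcont.continuousOn
    refine Integrable.of_bound
      (hcont.measurable.indicator measurableSet_closedBall).aestronglyMeasurable (max M 0) ?_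
    refine Filter.Eventually.of_forall fun u => ?_
    by_cases hu : u ∈ closedBall x h
    · rw [indicator_of_mem hu]; exact (hM u hu).trans (le_max_left _ _)
    · rw [indicator_of_notMem hu]; simp
  have hunit : ∀ v : (Fin d → Fin (l+1)) → ℝ, ∑ a, v a ^ 2 = 1 →
      ε ^ 2 * (μmin * (c0 * V0 / 2)) * h ^ d ≤
        ∫ u, (closedBall x h).indicator (fun u => pol v (h⁻¹ • (u - x)) ^ 2) u ∂PX := by
    intro v hv
    set Q : Euc d → ℝ := fun u => pol v (h⁻¹ • (u - x)) with hQ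
    have hQc : Continuous Q := (continuous_pol v).comp (by fun_prop)
    set G : Set (Euc d) := closedBall x h ∩ {u | ε < |Q u|} with hG
    have hGm : MeasurableSet G := measurableSet_closedBall.inter
      (measurableSet_lt measurable_const hQc.abs.measurable)
    set Bd : Set (Euc d) := closedBall x h ∩ {u | |Q u| ≤ ε} with hBd
    have hBdvol : volume Bd ≤ ENNReal.ofReal (h ^ d * (c0 * V0 / 2)) := by
      have : Bd = (fun u => u - x) ⁻¹' ((h⁻¹ • ·) ⁻¹'
          {u : Euc d | u ∈ closedBall (0 : Euc d) 1 ∧ |pol v u| ≤ ε}) := by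
        ext u
        simp only [hBd, hQ, mem_inter_iff, mem_ofPred_eq, mem_preimage, mem_closedBall,
          dist_eq_norm, sub_zero]
        rw [norm_smul, norm_inv, Real.norm_eq_abs, abs_of_pos hh, inv_mul_le_iff₀ hh, mul_one]
      simp only [sub_eq_add_neg] at this
      rw [this, measure_preimage_add_right, Measure.addHaar_preimage_smul _ (inv_ne_zero hh.ne')]
      simp only [finrank_euclideanSpace, Fintype.card_fin, inv_pow, inv_inv]
      rw [abs_of_pos (by positivity), ENNReal.ofReal_mul (by positivity)]
      gcongr
      exact hlev v hv
    have hBvol : volume (closedBall x h) = ENNReal.ofReal (h ^ d * V0) := by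
      rw [Measure.addHaar_closedBall' _ _ hh.le, ENNReal.ofReal_mul (by positivity), hV0,
        ofReal_measureReal measure_closedBall_lt_top.ne]
      simp
    have hAG : ENNReal.ofReal (h ^ d * (c0 * V0 / 2)) ≤ volume (A ∩ G) := by
      have h1 : volume (A ∩ closedBall x h) ≤ volume (A ∩ G) + volume Bd := by
        refine (measure_mono ?_).trans (measure_union_le _ _)
        rintro u ⟨hu1, hu2⟩
        by_cases hq : |Q u| ≤ ε
        · right; exact ⟨hu2, hq⟩
        · left; exact ⟨hu1, hu2, not_le.1 hq⟩
      have h2 : ENNReal.ofReal (h ^ d * (c0 * V0 / 2)) + ENNReal.ofReal (h ^ d * (c0 * V0 / 2)) ≤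
          volume (A ∩ G) + ENNReal.ofReal (h ^ d * (c0 * V0 / 2)) := by
        rw [← ENNReal.ofReal_add (by positivity) (by positivity)]
        have : h ^ d * (c0 * V0 / 2) + h ^ d * (c0 * V0 / 2) = c0 * (h ^ d * V0) := by ring
        rw [this, ENNReal.ofReal_mul hc0.le, ← hBvol]
        exact hA.trans (h1.trans (by gcongr))
      exact (ENNReal.add_le_add_iff_right ENNReal.ofReal_ne_top).1 h2
    have hPG : μmin * (h ^ d * (c0 * V0 / 2)) ≤ PX.real G := by
      have : ENNReal.ofReal (μmin * (h ^ d * (c0 * V0 / 2))) ≤ PX G := by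
        rw [ENNReal.ofReal_mul hμmin.le]
        exact (by gcongr : _ ≤ ENNReal.ofReal μmin * volume (A ∩ G)).trans (hPX G hGm)
      exact (ENNReal.ofReal_le_iff_le_toReal (measure_ne_top _ _)).1 this
    have hIntg : ∫ u, G.indicator (fun _ => ε ^ 2) u ∂PX = PX.real G * ε ^ 2 := by
      rw [integral_indicator_const _ hGm, smul_eq_mul]
    calc _ = ε ^ 2 * (μmin * (h ^ d * (c0 * V0 / 2))) := by ring
      _ ≤ PX.real G * ε ^ 2 := by nlinarith [sq_nonneg ε]
      _ = _ := hIntg.symm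
      _ ≤ _ := by
        refine integral_mono ((integrable_const _).indicator hGm) (hbound v) ?_
        intro u
        by_cases hu : u ∈ G
        · have hu' : u ∈ closedBall x h := hu.1
          have h3 : ε < |Q u| := hu.2
          simp only [indicator_of_mem hu, indicator_of_mem hu']
          rw [← sq_abs (pol v _)]
          exact pow_le_pow_left₀ hε.le h3.le 2
        · simp only [indicator_of_notMem hu]
          exact indicator_nonneg (fun _ _ => sq_nonneg _) _
  intro v
  set s := ∑ a, v a ^ 2 with hs
  have hs0 : 0 ≤ s := Finset.sum_nonneg fun a _ => sq_nonneg _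
  rcases hs0.eq_or_lt with h0 | h0
  · rw [← h0, mul_zero]
    exact integral_nonneg fun u => indicator_nonneg (fun _ _ => sq_nonneg _) _
  · have hw := hunit (fun a => (Real.sqrt s)⁻¹ * v a) (by
      simp only [mul_pow]
      rw [← Finset.mul_sum, ← hs, inv_pow, Real.sq_sqrt hs0, inv_mul_cancel₀ h0.ne'])
    have hp : ∀ u : Euc d, pol (fun a => (Real.sqrt s)⁻¹ * v a) u ^ 2 = s⁻¹ * pol v u ^ 2 := by
      intro u
      unfold pol
      simp only [mul_assoc]
      rw [← Finset.mul_sum, mul_pow, inv_pow, Real.sq_sqrt hs0]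
    simp only [hp] at hw
    have h5 : ∀ u, (closedBall x h).indicator (fun u => s⁻¹ * pol v (h⁻¹ • (u - x)) ^ 2) u
        = s⁻¹ * (closedBall x h).indicator (fun u => pol v (h⁻¹ • (u - x)) ^ 2) u := by
      intro u
      by_cases hu : u ∈ closedBall x h
      · simp only [indicator_of_mem hu]
      · simp only [indicator_of_notMem hu, mul_zero]
    simp only [h5, integral_const_mul] at hw
    rw [le_inv_mul_iff₀ h0] at hw
    linarith

lemma isPol_sum {d l : ℕ} {ι : Type*} (s : Finset ι) (f : ι → Euc d → ℝ)
    (hf : ∀ i ∈ s, ∃ v : (Fin d → Fin (l+1)) → ℝ, ∀ w, f i w = pol v w) :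
    ∃ v : (Fin d → Fin (l+1)) → ℝ, ∀ w, ∑ i ∈ s, f i w = pol v w := by
  classical
  induction s using Finset.induction_on with
  | empty => exact ⟨0, fun w => by simp [pol]⟩
  | insert i s his ih =>
    obtain ⟨v, hv⟩ := ih fun j hj => hf j (Finset.mem_insert_of_mem hj)
    obtain ⟨v', hv'⟩ := hf i (Finset.mem_insert_self _ _)
    refine ⟨v' + v, fun w => ?_⟩
    rw [Finset.sum_insert his, hv, hv']
    simp [pol, add_mul, Finset.sum_add_distrib]

lemma isPol_mul {d l : ℕ} (c : ℝ) (f : Euc d → ℝ)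
    (hf : ∃ v : (Fin d → Fin (l+1)) → ℝ, ∀ w, f w = pol v w) :
    ∃ v : (Fin d → Fin (l+1)) → ℝ, ∀ w, c * f w = pol v w := by
  obtain ⟨v, hv⟩ := hf
  refine ⟨fun a => c * v a, fun w => ?_⟩
  rw [hv]
  simp [pol, Finset.mul_sum, mul_assoc]

lemma isPol_multilinear {d l k : ℕ} (hk : k ≤ l)
    (T : ContinuousMultilinearMap ℝ (fun _ : Fin k => Euc d) ℝ) :
    ∃ v : (Fin d → Fin (l+1)) → ℝ, ∀ w, T (fun _ => w) = pol v w := by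
  classical
  have hexp : ∀ w : Euc d, T (fun _ => w) = ∑ r : Fin k → Fin d,
      T (fun j => EuclideanSpace.basisFun (Fin d) ℝ (r j)) * ∏ j, w (r j) := by
    intro w
    have hw : w = ∑ i, w i • EuclideanSpace.basisFun (Fin d) ℝ i := by
      conv_lhs => rw [← (EuclideanSpace.basisFun (Fin d) ℝ).sum_repr w]
      simp
    conv_lhs => rw [hw]
    rw [T.map_sum]
    refine Finset.sum_congr rfl fun r _ => ?_
    rw [T.map_smul_univ, smul_eq_mul, mul_comm]
  obtain ⟨v, hv⟩ := isPol_sum (l := l) Finset.univ (fun (r : Fin k → Fin d) (w : Euc d) =>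
      T (fun j => EuclideanSpace.basisFun (Fin d) ℝ (r j)) * ∏ j, w (r j)) (by
    intro r _
    apply isPol_mul
    let a : Fin d → Fin (l+1) := fun i => ⟨(Finset.univ.filter fun j => r j = i).card, by
      have := Finset.card_filter_le (Finset.univ : Finset (Fin k)) fun j => r j = i
      simp only [Finset.card_univ, Fintype.card_fin] at this
      omega⟩
    refine ⟨fun b => if b = a then 1 else 0, fun w => ?_⟩
    simp only [pol, ite_mul, one_mul, zero_mul, Finset.sum_ite_eq', Finset.mem_univ, if_true]
    unfold phi monom
    rw [← Finset.prod_fiberwise (s := Finset.univ) (g := r)]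
    refine Finset.prod_congr rfl fun i _ => ?_
    rw [Finset.prod_congr rfl (g := fun _ => w i), Finset.prod_const]
    intro j hj
    rw [(Finset.mem_filter.1 hj).2])
  exact ⟨v, fun w => by rw [hexp, hv]⟩

lemma taylor_pol {d : ℕ} (g : Euc d → ℝ) (l : ℕ) (x : Euc d) (h : ℝ) (hh : 0 < h) :
    ∃ v : (Fin d → Fin (l+1)) → ℝ, ∀ u, taylorPoly g l x u = pol v (h⁻¹ • (u - x)) := by
  obtain ⟨v, hv⟩ := isPol_sum (l := l) (Finset.range (l+1)) (fun k (w : Euc d) =>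
    ((k.factorial : ℝ)⁻¹ * h ^ k) * iteratedFDeriv ℝ k g x (fun _ => w)) (by
      intro k hk
      apply isPol_mul
      exact isPol_multilinear (by have := Finset.mem_range.1 hk; omega) _)
  refine ⟨v, fun u => ?_⟩
  rw [← hv]
  unfold taylorPoly
  refine Finset.sum_congr rfl fun k _ => ?_
  have h1 : (fun _ : Fin k => u - x) = fun _ => h • (h⁻¹ • (u - x)) := by
    funext _; rw [smul_smul, mul_inv_cancel₀ hh.ne', one_smul]
  rw [h1, ContinuousMultilinearMap.map_smul_univ (c := fun _ => h)]
  simp only [Finset.prod_const, Finset.card_univ, Fintype.card_fin, smul_eq_mul, mul_assoc]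

lemma exp_le_quad {u : ℝ} (hu : |u| ≤ 1) : Real.exp u ≤ 1 + u + u ^ 2 := by
  have := Real.abs_exp_sub_one_sub_id_le hu
  have := (abs_le.1 this).2
  linarith

lemma conc_one {Ω : Type*} [MeasurableSpace Ω] (P : Measure Ω) [IsProbabilityMeasure P]
    (f : Ω → ℝ) (hf : Measurable f) (M V H s : ℝ) (hM : 1 ≤ M) (hV : 1 ≤ V)
    (hs : 0 < s) (hs2 : s ≤ 2) (hfM : ∀ ω, |f ω| ≤ M) (hf2 : ∫ ω, f ω ^ 2 ∂P ≤ M ^ 2 * V * H)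
    (n : ℕ) :
    Measure.pi (fun _ : Fin n => P) {ω | n * H * s ≤ ∑ i, f (ω i) - n * ∫ ω, f ω ∂P} ≤
      ENNReal.ofReal (Real.exp (-(n * H * s ^ 2 / (4 * M ^ 2 * V)))) := by
  set t : ℝ := s / (2 * M ^ 2 * V) with ht
  have hM0 : 0 < M := by linarith
  have hV0 : 0 < V := by linarith
  have ht0 : 0 < t := by positivity
  have htM : t * M ≤ 1 := by
    rw [ht, div_mul_eq_mul_div, div_le_one (by positivity)]
    nlinarith [mul_le_mul hM hV zero_le_one hM0.le]
  set m : ℝ := ∫ ω, f ω ∂P with hm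
  have hfint : Integrable f P := Integrable.of_bound hf.aestronglyMeasurable M
    (Filter.Eventually.of_forall hfM)
  have hf2int : Integrable (fun ω => f ω ^ 2) P :=
    Integrable.of_bound (hf.pow_const 2).aestronglyMeasurable (M ^ 2)
      (Filter.Eventually.of_forall fun ω => by
        rw [Real.norm_eq_abs, abs_pow]; exact pow_le_pow_left₀ (abs_nonneg _) (hfM ω) 2)
  have hmeas : Measurable fun ω => Real.exp (t * f ω) := by fun_prop
  have hle : ∀ ω, Real.exp (t * f ω) ≤ 1 + t * f ω + t ^ 2 * f ω ^ 2 := by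
    intro ω
    have : |t * f ω| ≤ 1 := by
      rw [abs_mul, abs_of_pos ht0]
      exact (mul_le_mul_of_nonneg_left (hfM ω) ht0.le).trans htM
    have := exp_le_quad this
    rwa [mul_pow] at this
  have hRint : Integrable (fun ω => 1 + t * f ω + t ^ 2 * f ω ^ 2) P :=
    ((integrable_const _).add (hfint.const_mul t)).add (hf2int.const_mul _)
  have hEint : Integrable (fun ω => Real.exp (t * f ω)) P :=
    hRint.mono' hmeas.aestronglyMeasurable (Filter.Eventually.of_forall fun ω => by
      rw [Real.norm_eq_abs, Real.abs_exp]; exact hle ω)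
  have hmgf : ∫ ω, Real.exp (t * f ω) ∂P ≤ Real.exp (t * m + t ^ 2 * (M ^ 2 * V * H)) := by
    calc _ ≤ ∫ ω, (1 + t * f ω + t ^ 2 * f ω ^ 2) ∂P := integral_mono hEint hRint hle
      _ = 1 + t * m + t ^ 2 * ∫ ω, f ω ^ 2 ∂P := by
        have hI1 : Integrable (fun ω => 1 + t * f ω) P :=
          (integrable_const _).add (hfint.const_mul t)
        rw [integral_add hI1 (hf2int.const_mul _), integral_add (integrable_const _) (hfint.const_mul t), integral_const_mul,
          integral_const_mul]
        simp [hm]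
      _ ≤ 1 + (t * m + t ^ 2 * (M ^ 2 * V * H)) := by
        have := mul_le_mul_of_nonneg_left hf2 (sq_nonneg t); linarith
      _ ≤ _ := by
        have := Real.add_one_le_exp (t * m + t ^ 2 * (M ^ 2 * V * H)); linarith
  have hpi : ∫ ω, ∏ i, Real.exp (t * f (ω i)) ∂(Measure.pi fun _ : Fin n => P) =
      (∫ ω, Real.exp (t * f ω) ∂P) ^ n := by
    have := integral_fintype_prod_eq_pow (ι := Fin n) (μ := P) (fun ω => Real.exp (t * f ω))
    simpa using this
  have hpiint : Integrable (fun ω : Fin n → Ω => ∏ i, Real.exp (t * f (ω i)))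
      (Measure.pi fun _ : Fin n => P) :=
    Integrable.fintype_prod (f := fun _ ω => Real.exp (t * f ω)) fun _ => hEint
  have hmark := mul_meas_ge_le_integral_of_nonneg
    (Filter.Eventually.of_forall fun ω => Finset.prod_nonneg fun i _ => (Real.exp_pos _).le)
    hpiint (Real.exp (t * (n * m + n * H * s)))
  have hsub : {ω : Fin n → Ω | n * H * s ≤ ∑ i, f (ω i) - n * m} ⊆
      {ω | Real.exp (t * (n * m + n * H * s)) ≤ ∏ i, Real.exp (t * f (ω i))} := by
    intro ω hω
    have hω' : n * H * s ≤ ∑ i, f (ω i) - n * m := hω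
    rw [mem_ofPred_eq, ← Real.exp_sum, Real.exp_le_exp, ← Finset.mul_sum]
    apply mul_le_mul_of_nonneg_left _ ht0.le
    linarith
  refine (measure_mono hsub).trans ?_
  rw [ENNReal.le_ofReal_iff_toReal_le (measure_ne_top _ _) (Real.exp_pos _).le]
  change Measure.real _ _ ≤ _
  rw [hpi] at hmark
  have h2 : (∫ ω, Real.exp (t * f ω) ∂P) ^ n ≤
      Real.exp (n * (t * m + t ^ 2 * (M ^ 2 * V * H))) := by
    rw [Real.exp_nat_mul]
    exact pow_le_pow_left₀ (integral_nonneg fun _ => (Real.exp_pos _).le) hmgf n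
  have h3 := hmark.trans h2
  rw [mul_comm, ← le_div_iff₀ (Real.exp_pos _), ← Real.exp_sub] at h3
  refine h3.trans (Real.exp_le_exp.2 (le_of_eq ?_))
  rw [ht]
  field_simp
  ring

lemma conc {Ω : Type*} [MeasurableSpace Ω] (P : Measure Ω) [IsProbabilityMeasure P]
    (f : Ω → ℝ) (hf : Measurable f) (M V H s : ℝ) (hM : 1 ≤ M) (hV : 1 ≤ V)
    (hs : 0 < s) (hs2 : s ≤ 2) (hfM : ∀ ω, |f ω| ≤ M) (hf2 : ∫ ω, f ω ^ 2 ∂P ≤ M ^ 2 * V * H)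
    (n : ℕ) :
    Measure.pi (fun _ : Fin n => P) {ω | n * H * s ≤ |∑ i, f (ω i) - n * ∫ ω, f ω ∂P|} ≤
      ENNReal.ofReal (2 * Real.exp (-(n * H * s ^ 2 / (4 * M ^ 2 * V)))) := by
  have h1 := conc_one P f hf M V H s hM hV hs hs2 hfM hf2 n
  have h2 := conc_one P (fun ω => - f ω) hf.neg M V H s hM hV hs hs2 (by simpa using hfM)
    (by simpa using hf2) n
  have hsub : {ω : Fin n → Ω | n * H * s ≤ |∑ i, f (ω i) - n * ∫ ω, f ω ∂P|} ⊆
      {ω | n * H * s ≤ ∑ i, f (ω i) - n * ∫ ω, f ω ∂P} ∪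
      {ω | n * H * s ≤ ∑ i, (- f (ω i)) - n * ∫ ω, (- f ω) ∂P} := by
    intro ω hω
    have hω' : n * H * s ≤ |∑ i, f (ω i) - n * ∫ ω, f ω ∂P| := hω
    rcases le_abs.1 hω' with h | h
    · left; exact h
    · right
      rw [mem_ofPred_eq, integral_neg, Finset.sum_neg_distrib]
      linarith
  refine (measure_mono hsub).trans ((measure_union_le _ _).trans ((add_le_add h1 h2).trans ?_))
  rw [← ENNReal.ofReal_add (Real.exp_pos _).le (Real.exp_pos _).le, two_mul]

lemma jointLaw_eq {d : ℕ} (PX : Measure (Euc d)) (η : Euc d → ℝ) (hη : Measurable η) :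
    jointLaw PX η = (PX.withDensity fun x => ENNReal.ofReal (η x)).map (fun x => (x, true)) +
      (PX.withDensity fun x => ENNReal.ofReal (1 - η x)).map (fun x => (x, false)) := by
  have h1 : Measurable fun x : Euc d => (x, true) := by fun_prop
  have h2 : Measurable fun x : Euc d => (x, false) := by fun_prop
  have hk : Measurable fun x : Euc d => ENNReal.ofReal (η x) • Measure.dirac (x, true) +
      ENNReal.ofReal (1 - η x) • Measure.dirac (x, false) := by
    refine Measure.measurable_of_measurable_coe _ fun s hs => ?_
    simp only [Measure.add_apply, Measure.smul_apply, smul_eq_mul]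
    have e1 : Measurable fun x : Euc d => (Measure.dirac (x, true)) s :=
      (Measure.measurable_coe hs).comp (Measure.measurable_dirac.comp h1)
    have e2 : Measurable fun x : Euc d => (Measure.dirac (x, false)) s :=
      (Measure.measurable_coe hs).comp (Measure.measurable_dirac.comp h2)
    fun_prop
  ext s hs
  unfold jointLaw
  rw [Measure.bind_apply hs hk.aemeasurable, Measure.add_apply, Measure.map_apply h1 hs,
    Measure.map_apply h2 hs, withDensity_apply _ (h1 hs), withDensity_apply _ (h2 hs),
    ← lintegral_indicator (h1 hs), ← lintegral_indicator (h2 hs), ← lintegral_add_left]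
  · refine lintegral_congr fun x => ?_
    simp only [Measure.add_apply, Measure.smul_apply, smul_eq_mul, Measure.dirac_apply' _ hs]
    congr 1
    · by_cases hx : (x, true) ∈ s
      · rw [indicator_of_mem hx, indicator_of_mem (by exact hx)]; simp
      · rw [indicator_of_notMem hx, indicator_of_notMem (by exact hx)]; simp
    · by_cases hx : (x, false) ∈ s
      · rw [indicator_of_mem hx, indicator_of_mem (by exact hx)]; simp
      · rw [indicator_of_notMem hx, indicator_of_notMem (by exact hx)]; simp
  · exact (hη.ennreal_ofReal).indicator (h1 hs)

lemma integral_jointLaw {d : ℕ} (PX : Measure (Euc d)) [IsProbabilityMeasure PX] (η : Euc d → ℝ)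
    (hη : Measurable η) (hη01 : ∀ x, η x ∈ Icc (0 : ℝ) 1) (F : Euc d × Bool → ℝ)
    (hF : Measurable F) (M : ℝ) (hM : ∀ z, |F z| ≤ M) :
    ∫ z, F z ∂(jointLaw PX η) = ∫ x, (η x * F (x, true) + (1 - η x) * F (x, false)) ∂PX := by
  have h1 : Measurable fun x : Euc d => (x, true) := by fun_prop
  have h2 : Measurable fun x : Euc d => (x, false) := by fun_prop
  have hb : ∀ g : Euc d → ℝ, Measurable g → (∀ x, g x ∈ Icc (0 : ℝ) 1) → ∀ b : Bool,
      Integrable (fun x => g x * F (x, b)) PX := by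
    intro g hg hg1 b
    refine Integrable.of_bound (by fun_prop) M (Filter.Eventually.of_forall fun x => ?_)
    rw [Real.norm_eq_abs, abs_mul, abs_of_nonneg (hg1 x).1]
    have := hM (x, b)
    nlinarith [(hg1 x).1, (hg1 x).2, abs_nonneg (F (x, b))]
  have h01' : ∀ x, 1 - η x ∈ Icc (0 : ℝ) 1 := fun x =>
    ⟨by linarith [(hη01 x).2], by linarith [(hη01 x).1]⟩
  have hI : ∀ g : Euc d → ℝ, Measurable g → (∀ x, g x ∈ Icc (0 : ℝ) 1) → ∀ b : Bool,
      Integrable F ((PX.withDensity fun x => ENNReal.ofReal (g x)).map (fun x => (x, b))) ∧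
      ∫ z, F z ∂((PX.withDensity fun x => ENNReal.ofReal (g x)).map (fun x => (x, b))) =
        ∫ x, g x * F (x, b) ∂PX := by
    intro g hg hg1 b
    have h3 : Measurable fun x : Euc d => (x, b) := by fun_prop
    constructor
    · rw [integrable_map_measure hF.aestronglyMeasurable h3.aemeasurable,
        integrable_withDensity_iff_integrable_smul' hg.ennreal_ofReal (by simp)]
      refine (hb g hg hg1 b).congr (Filter.Eventually.of_forall fun x => ?_)
      simp [ENNReal.toReal_ofReal (hg1 x).1]
    · rw [integral_map h3.aemeasurable hF.aestronglyMeasurable,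
        integral_withDensity_eq_integral_toReal_smul hg.ennreal_ofReal (by simp)]
      refine integral_congr_ae (Filter.Eventually.of_forall fun x => ?_)
      simp [ENNReal.toReal_ofReal (hg1 x).1]
  have hη' : Measurable fun x => 1 - η x := measurable_const.sub hη
  rw [jointLaw_eq PX η hη, integral_add_measure (hI η hη hη01 true).1
    (hI _ hη' h01' false).1, (hI η hη hη01 true).2,
    (hI _ hη' h01' false).2, integral_add (hb η hη hη01 true)
    (hb _ hη' h01' false)]

lemma isProb_jointLaw {d : ℕ} (PX : Measure (Euc d)) [IsProbabilityMeasure PX] (η : Euc d → ℝ)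
    (hη : Measurable η) (hη01 : ∀ x, η x ∈ Icc (0 : ℝ) 1) :
    IsProbabilityMeasure (jointLaw PX η) := by
  have h1 : Measurable fun x : Euc d => (x, true) := by fun_prop
  have h2 : Measurable fun x : Euc d => (x, false) := by fun_prop
  constructor
  rw [jointLaw_eq PX η hη, Measure.add_apply, Measure.map_apply h1 MeasurableSet.univ,
    Measure.map_apply h2 MeasurableSet.univ, preimage_univ, preimage_univ,
    withDensity_apply _ MeasurableSet.univ, withDensity_apply _ MeasurableSet.univ,
    Measure.restrict_univ, ← lintegral_add_left hη.ennreal_ofReal]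
  have : ∀ x, ENNReal.ofReal (η x) + ENNReal.ofReal (1 - η x) = 1 := by
    intro x
    rw [← ENNReal.ofReal_add (hη01 x).1 (by linarith [(hη01 x).2])]
    simp
  simp [this]

lemma measurable_det {Ω ι : Type*} [MeasurableSpace Ω] [Fintype ι] [DecidableEq ι]
    (G : Ω → Matrix ι ι ℝ) (hG : ∀ i j, Measurable fun ω => G ω i j) :
    Measurable fun ω => (G ω).det := by
  simp only [Matrix.det_apply]
  refine Finset.measurable_sum _ fun σ _ => ?_
  refine Measurable.const_smul (Finset.measurable_prod _ fun i _ => hG _ _) _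

lemma lin_err {ι : Type*} [Fintype ι] [DecidableEq ι] (G : Matrix ι ι ℝ) (r θ : ι → ℝ)
    (N lam m : ℝ) (hN : 0 < N) (hlam : 0 < lam) (hm : 0 ≤ m)
    (hcoer : ∀ v : ι → ℝ, lam * N * ∑ a, v a ^ 2 ≤ ∑ a, ∑ b, v a * v b * G a b)
    (hS : ∀ a, |r a - ∑ b, G a b * θ b| ≤ N * m) (a0 : ι) :
    |(G.det)⁻¹ * (G.updateCol a0 r).det - θ a0| ≤ m * Fintype.card ι / lam := by
  have hquad : ∀ v : ι → ℝ, ∑ a, ∑ b, v a * v b * G a b = ∑ a, v a * (G.mulVec v) a := by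
    intro v
    refine Finset.sum_congr rfl fun a _ => ?_
    rw [Matrix.mulVec, dotProduct, Finset.mul_sum]
    refine Finset.sum_congr rfl fun b _ => by ring
  have hdet : G.det ≠ 0 := by
    intro h
    obtain ⟨v, hv, hGv⟩ := Matrix.exists_mulVec_eq_zero_iff.2 h
    have h1 := hcoer v
    rw [hquad, hGv] at h1
    simp only [Pi.zero_apply, mul_zero, Finset.sum_const_zero] at h1
    have h2 : 0 < ∑ a, v a ^ 2 := by
      obtain ⟨i, hi⟩ := Function.ne_iff.1 hv
      have hi' : 0 < v i ^ 2 := by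
        have : v i ≠ 0 := hi
        positivity
      exact hi'.trans_le (Finset.single_le_sum (f := fun a => v a ^ 2) (fun j _ => sq_nonneg _)
        (Finset.mem_univ i))
    have : 0 < lam * N * ∑ a, v a ^ 2 := by positivity
    linarith
  set D : ι → ℝ := (G.det)⁻¹ • (G.cramer r) - θ with hD
  have hGD : ∀ a, (G.mulVec D) a = r a - ∑ b, G a b * θ b := by
    intro a
    rw [hD, Matrix.mulVec_sub, Matrix.mulVec_smul, Matrix.mulVec_cramer, smul_smul,
      inv_mul_cancel₀ hdet, one_smul]
    rfl
  have hDa : (G.det)⁻¹ * (G.updateCol a0 r).det - θ a0 = D a0 := by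
    rw [hD]
    simp [Matrix.cramer_apply]
  rw [hDa]
  set q := ∑ a, D a ^ 2 with hq
  have hq0 : 0 ≤ q := Finset.sum_nonneg fun a _ => sq_nonneg _
  have hle : ∀ a, |D a| ≤ Real.sqrt q := by
    intro a
    apply Real.abs_le_sqrt
    exact Finset.single_le_sum (f := fun a => D a ^ 2) (fun j _ => sq_nonneg _) (Finset.mem_univ a)
  have h1 := hcoer D
  rw [hquad] at h1
  have h2 : ∑ a, D a * (G.mulVec D) a ≤ Fintype.card ι * (Real.sqrt q * (N * m)) := by
    have : ∀ a ∈ (Finset.univ : Finset ι), D a * (G.mulVec D) a ≤ Real.sqrt q * (N * m) := by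
      intro a _
      refine (le_abs_self _).trans ?_
      rw [abs_mul, hGD]
      exact mul_le_mul (hle a) (hS a) (abs_nonneg _) (Real.sqrt_nonneg _)
    have := Finset.sum_le_card_nsmul _ _ _ this
    simpa using this
  refine (hle a0).trans ?_
  rw [le_div_iff₀ hlam]
  rcases (Real.sqrt_nonneg q).eq_or_lt with h0 | h0
  · rw [← h0, zero_mul]; positivity
  · have h3 : lam * N * q ≤ Fintype.card ι * (Real.sqrt q * (N * m)) := h1.trans h2
    have h4 : q = Real.sqrt q * Real.sqrt q := (Real.mul_self_sqrt hq0).symm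
    have h5 : (N * Real.sqrt q) * (Real.sqrt q * lam) ≤ (N * Real.sqrt q) * (m * Fintype.card ι) := by
      calc _ = lam * N * (Real.sqrt q * Real.sqrt q) := by ring
        _ = lam * N * q := by rw [← h4]
        _ ≤ _ := h3
        _ = _ := by ring
    exact le_of_mul_le_mul_left h5 (by positivity)

open Classical in
/-- localized features -/
def psi {d l : ℕ} (h : ℝ) (x : Euc d) (a : Fin d → Fin (l+1)) (u : Euc d) : ℝ :=
  if ‖u - x‖ ≤ h then phi a (h⁻¹ • (u - x)) else 0

/-- real label -/
def lab (b : Bool) : ℝ := if b then 1 else 0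

/-- local Gram matrix -/
def gram {d : ℕ} (l : ℕ) (h : ℝ) {n : ℕ} (ω : Sample d n) (x : Euc d) :
    Matrix (Fin d → Fin (l+1)) (Fin d → Fin (l+1)) ℝ :=
  fun a b => ∑ i, psi h x a (ω i).1 * psi h x b (ω i).1

/-- local response vector -/
def resp {d : ℕ} (l : ℕ) (h : ℝ) {n : ℕ} (ω : Sample d n) (x : Euc d) :
    (Fin d → Fin (l+1)) → ℝ :=
  fun a => ∑ i, psi h x a (ω i).1 * lab (ω i).2

/-- unclipped local polynomial estimator -/
def rawEst {d : ℕ} (l : ℕ) (h : ℝ) {n : ℕ} (ω : Sample d n) (x : Euc d) : ℝ :=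
  ((gram l h ω x).det)⁻¹ * ((gram l h ω x).updateCol 0 (resp l h ω x)).det

/-- clipped local polynomial estimator -/
def est {d : ℕ} (l : ℕ) (h : ℝ) {n : ℕ} (ω : Sample d n) (x : Euc d) : ℝ :=
  max 0 (min 1 (rawEst l h ω x))

lemma measurable_psi {Ω : Type*} [MeasurableSpace Ω] {d l : ℕ} (h : ℝ) (a : Fin d → Fin (l+1))
    (f g : Ω → Euc d) (hf : Measurable f) (hg : Measurable g) :
    Measurable fun ω => psi h (f ω) a (g ω) := by
  unfold psi
  refine Measurable.ite ?_ ?_ measurable_const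
  · exact measurableSet_le (hg.sub hf).norm measurable_const
  · have h1 : Measurable fun ω => h⁻¹ • (g ω - f ω) := by fun_prop
    exact (continuous_phi a).measurable.comp h1

lemma measurable_lab : Measurable lab := measurable_of_finite _

lemma measurable_est {d : ℕ} (l : ℕ) (h : ℝ) (n : ℕ) :
    Measurable (Function.uncurry (fun (ω : Sample d n) x => est l h ω x)) := by
  have hp : ∀ (a : Fin d → Fin (l+1)) (i : Fin n), Measurable fun q : Sample d n × Euc d =>
      psi h q.2 a (q.1 i).1 := by
    intro a i
    have h1 : Measurable fun q : Sample d n × Euc d => q.2 := measurable_snd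
    have h2 : Measurable fun q : Sample d n × Euc d => (q.1 i).1 := by fun_prop
    exact measurable_psi h a _ _ h1 h2
  have hG : ∀ a b, Measurable fun q : Sample d n × Euc d => gram l h q.1 q.2 a b := by
    intro a b
    unfold gram
    exact Finset.measurable_sum _ fun i _ => (hp a i).mul (hp b i)
  have hr : ∀ a, Measurable fun q : Sample d n × Euc d => resp l h q.1 q.2 a := by
    intro a
    unfold resp
    refine Finset.measurable_sum _ fun i _ => (hp a i).mul ?_
    have h2 : Measurable fun q : Sample d n × Euc d => (q.1 i).2 := by fun_prop
    exact measurable_lab.comp h2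
  have hraw : Measurable fun q : Sample d n × Euc d => rawEst l h q.1 q.2 := by
    have hU : ∀ a b, Measurable fun q : Sample d n × Euc d =>
        ((gram l h q.1 q.2).updateCol 0 (resp l h q.1 q.2)) a b := by
      intro a b
      simp only [Matrix.updateCol_apply]
      by_cases hb : b = 0
      · simp only [if_pos hb]; exact hr a
      · simp only [if_neg hb]; exact hG a b
    have h1 := measurable_det (fun q : Sample d n × Euc d => gram l h q.1 q.2) hG
    have h2 := measurable_det (fun q : Sample d n × Euc d =>
      (gram l h q.1 q.2).updateCol 0 (resp l h q.1 q.2)) hU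
    exact h1.inv.mul h2
  have := (measurable_const (a := (0 : ℝ))).max ((measurable_const (a := (1 : ℝ))).min hraw)
  exact this

lemma est_mem {d : ℕ} (l : ℕ) (h : ℝ) {n : ℕ} (ω : Sample d n) (x : Euc d) :
    est l h ω x ∈ Icc (0 : ℝ) 1 :=
  ⟨le_max_left _ _, max_le zero_le_one (min_le_left _ _)⟩

lemma est_err {d : ℕ} (l : ℕ) (h : ℝ) {n : ℕ} (ω : Sample d n) (x : Euc d) (y : ℝ)
    (hy : y ∈ Icc (0 : ℝ) 1) : |est l h ω x - y| ≤ |rawEst l h ω x - y| := by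
  unfold est
  obtain ⟨h0, h1⟩ := hy
  generalize rawEst l h ω x = t
  have hA : max 0 (min 1 y) = y := by rw [min_eq_right h1, max_eq_right h0]
  calc |max 0 (min 1 t) - y| = |max 0 (min 1 t) - max 0 (min 1 y)| := by rw [hA]
    _ ≤ |min 1 t - min 1 y| := by
      simpa using abs_max_sub_max_le_max (0 : ℝ) (min 1 t) 0 (min 1 y)
    _ ≤ |t - y| := by simpa using abs_min_sub_min_le_max (1 : ℝ) t 1 y

open Classical in
lemma int_ball {d : ℕ} (PX : Measure (Euc d)) [IsProbabilityMeasure PX] (x : Euc d) (h B : ℝ)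
    (g : Euc d → ℝ) (hg : ∀ u, |g u| ≤ if ‖u - x‖ ≤ h then B else 0) :
    |∫ u, g u ∂PX| ≤ B * PX.real (closedBall x h) := by
  have h1 : ∀ u, ‖g u‖ ≤ (closedBall x h).indicator (fun _ => B) u := by
    intro u
    have := hg u
    rw [indicator_apply]
    simpa [dist_eq_norm] using this
  have := norm_integral_le_of_norm_le
    ((integrable_const B).indicator (measurableSet_closedBall (x := x) (ε := h)))
    (Filter.Eventually.of_forall h1 : ∀ᵐ u ∂PX, _)
  rw [integral_indicator_const _ measurableSet_closedBall, smul_eq_mul, mul_comm] at this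
  exact this

lemma abs_psi_le {d l : ℕ} (h : ℝ) (hh : 0 < h) (x : Euc d) (a : Fin d → Fin (l+1)) (u : Euc d) :
    |psi h x a u| ≤ 1 := by
  unfold psi
  split_ifs with hu
  · apply abs_phi_le
    rw [norm_smul, norm_inv, Real.norm_eq_abs, abs_of_pos hh, inv_mul_le_iff₀ hh, mul_one]
    exact hu
  · simp

lemma psi_off {d l : ℕ} (h : ℝ) (x : Euc d) (a : Fin d → Fin (l+1)) (u : Euc d)
    (hu : ¬ ‖u - x‖ ≤ h) : psi h x a u = 0 := by
  unfold psi; rw [if_neg hu]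

lemma psi_pol {d l : ℕ} (h : ℝ) (x : Euc d) (a : Fin d → Fin (l+1)) (u : Euc d)
    (θ : (Fin d → Fin (l+1)) → ℝ) :
    psi h x a u * pol θ (h⁻¹ • (u - x)) = ∑ b, psi h x a u * psi h x b u * θ b := by
  by_cases hu : ‖u - x‖ ≤ h
  · unfold pol
    rw [Finset.mul_sum]
    refine Finset.sum_congr rfl fun b _ => ?_
    unfold psi
    rw [if_pos hu, if_pos hu]; ring
  · rw [psi_off h x a u hu]; simp

open Classical in
lemma sq_joint {d : ℕ} (PX : Measure (Euc d)) [IsProbabilityMeasure PX] (η : Euc d → ℝ)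
    (hη : Measurable η) (hη01 : ∀ x, η x ∈ Icc (0 : ℝ) 1) (x : Euc d) (h M : ℝ)
    (F : Euc d × Bool → ℝ) (hF : Measurable F)
    (hFM : ∀ z, |F z| ≤ if ‖z.1 - x‖ ≤ h then M else 0) :
    ∫ z, F z ^ 2 ∂(jointLaw PX η) ≤ M ^ 2 * PX.real (closedBall x h) := by
  have hsq : ∀ z, F z ^ 2 ≤ if ‖z.1 - x‖ ≤ h then M ^ 2 else 0 := by
    intro z
    have := hFM z
    rw [← sq_abs]
    split_ifs at this ⊢ with hz
    · exact pow_le_pow_left₀ (abs_nonneg _) this 2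
    · have : |F z| = 0 := le_antisymm this (abs_nonneg _)
      rw [this]; simp
  rw [integral_jointLaw PX η hη hη01 (fun z => F z ^ 2) (hF.pow_const 2) (M ^ 2)]
  · refine (le_abs_self _).trans (int_ball PX x h (M ^ 2) _ fun u => ?_)
    have h1 := hsq (u, true)
    have h2 := hsq (u, false)
    have e1 := (hη01 u).1
    have e2 := (hη01 u).2
    rw [abs_of_nonneg (by have := sq_nonneg (F (u, true)); have := sq_nonneg (F (u, false)); nlinarith)]
    simp only at h1 h2
    have h3 := mul_le_mul_of_nonneg_left h1 e1
    have h4 := mul_le_mul_of_nonneg_left h2 (sub_nonneg.2 e2)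
    split_ifs at h3 h4 ⊢ <;> linarith
  · intro z
    rw [abs_of_nonneg (sq_nonneg _)]
    have := hsq z
    split_ifs at this
    · exact this
    · exact this.trans (sq_nonneg _)

lemma sum_abs_quad {ι : Type*} [Fintype ι] (v : ι → ℝ) (E : ι → ι → ℝ) (s : ℝ)
    (hE : ∀ a b, |E a b| ≤ s) :
    -(s * Fintype.card ι * ∑ a, v a ^ 2) ≤ ∑ a, ∑ b, v a * v b * E a b := by
  have h1 : ∀ a b, -(s * ((v a ^ 2 + v b ^ 2) / 2)) ≤ v a * v b * E a b := by
    intro a b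
    have h2 : |v a * v b * E a b| ≤ s * ((v a ^ 2 + v b ^ 2) / 2) := by
      rw [abs_mul, mul_comm]
      refine mul_le_mul (hE a b) ?_ (abs_nonneg _) ((abs_nonneg _).trans (hE a b))
      rw [abs_le]; constructor <;> nlinarith [sq_nonneg (v a - v b), sq_nonneg (v a + v b)]
    exact (abs_le.1 h2).1
  refine le_trans (le_of_eq ?_) (Finset.sum_le_sum fun a _ => Finset.sum_le_sum fun b _ => h1 a b)
  simp only [Finset.sum_neg_distrib, ← Finset.mul_sum, ← Finset.sum_div, Finset.sum_add_distrib,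
    Finset.sum_const, Finset.card_univ, nsmul_eq_mul]
  ring

open Classical in
lemma core {d l n : ℕ} (hn : 1 ≤ n) (PX : Measure (Euc d)) [IsProbabilityMeasure PX]
    (η : Euc d → ℝ) (hη : Measurable η) (hη01 : ∀ x, η x ∈ Icc (0 : ℝ) 1) (x : Euc d)
    (h : ℝ) (hh : 0 < h) (L B : ℝ) (hL : 0 < L) (hB : 0 ≤ B) (hBL : B ≤ L)
    (θ : (Fin d → Fin (l+1)) → ℝ)
    (hθ : ∀ u, ‖u - x‖ ≤ h → |η u - pol θ (h⁻¹ • (u - x))| ≤ B) (hθ0 : θ 0 = η x)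
    (V : ℝ) (hV : 1 ≤ V) (hPV : PX.real (closedBall x h) ≤ V * h ^ d)
    (lam : ℝ) (hlam : 0 < lam)
    (hcoer : ∀ v : (Fin d → Fin (l+1)) → ℝ, lam * h ^ d * ∑ a, v a ^ 2 ≤
        ∫ u, (closedBall x h).indicator (fun u => pol v (h⁻¹ • (u - x)) ^ 2) u ∂PX)
    (p : ℝ) (hp : p = Fintype.card (Fin d → Fin (l+1)))
    (δ : ℝ) (hδ : 0 < δ) (hδ1 : δ ≤ 1)
    (hbias : B * V * (2 * p) / lam ≤ δ / 4)
    (s0 : ℝ) (hs0 : 0 < s0) (hs01 : s0 ≤ 1) (hs0l : s0 ≤ lam / (8 * p)) :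
    sampleLaw PX η n {ω | δ ≤ |est l h ω x - η x|} ≤
      ENNReal.ofReal ((p + p ^ 2) *
        (2 * Real.exp (-(n * h ^ d * (s0 * δ) ^ 2 / (4 * (1 + L) ^ 2 * V))))) := by
  have hprob := isProb_jointLaw PX η hη hη01
  set P := jointLaw PX η with hP
  have hp1 : 1 ≤ p := by
    rw [hp]; exact_mod_cast Fintype.card_pos
  have hp0 : 0 < p := by linarith
  have hn0 : (0 : ℝ) < n := by exact_mod_cast hn
  have hH : 0 < h ^ d := by positivity
  set H := h ^ d with hHdef
  set s := s0 * δ with hs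
  have hsp : 0 < s := by positivity
  have hss0 : s ≤ s0 := by rw [hs]; nlinarith
  have hs2 : s ≤ 2 := by linarith
  have hpsim : ∀ a : Fin d → Fin (l+1), Measurable fun z : Euc d × Bool => psi h x a z.1 :=
    fun a => by
      have h1 : Measurable fun _ : Euc d × Bool => x := measurable_const
      have h2 : Measurable fun z : Euc d × Bool => z.1 := measurable_fst
      exact measurable_psi h a _ _ h1 h2
  -- the two families of functions
  set f1 : (Fin d → Fin (l+1)) → Euc d × Bool → ℝ := fun a z =>
    psi h x a z.1 * (lab z.2 - pol θ (h⁻¹ • (z.1 - x))) with hf1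
  set f2 : (Fin d → Fin (l+1)) → (Fin d → Fin (l+1)) → Euc d × Bool → ℝ := fun a b z =>
    psi h x a z.1 * psi h x b z.1 with hf2
  have hf1m : ∀ a, Measurable (f1 a) := by
    intro a
    have h1 : Measurable fun z : Euc d × Bool => h⁻¹ • (z.1 - x) := by fun_prop
    have h2 : Measurable fun z : Euc d × Bool => pol θ (h⁻¹ • (z.1 - x)) :=
      (continuous_pol θ).measurable.comp h1
    have h3 : Measurable fun z : Euc d × Bool => lab z.2 := measurable_lab.comp measurable_snd
    exact (hpsim a).mul (h3.sub h2)
  have hf2m : ∀ a b, Measurable (f2 a b) := fun a b => (hpsim a).mul (hpsim b)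
  have hf1b : ∀ a z, |f1 a z| ≤ if ‖z.1 - x‖ ≤ h then 1 + L else 0 := by
    intro a z
    simp only [hf1]
    split_ifs with hz
    · rw [abs_mul]
      have e1 := abs_psi_le h hh x a z.1
      have e2 := hθ z.1 hz
      have e3 : |lab z.2 - η z.1| ≤ 1 := by
        have := hη01 z.1
        unfold lab
        split_ifs
        · rw [abs_of_nonneg (by linarith [this.2])]; linarith [this.1]
        · rw [abs_of_nonpos (by linarith [this.1])]; linarith [this.2]
      have e4 : |lab z.2 - pol θ (h⁻¹ • (z.1 - x))| ≤ 1 + L := by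
        have := abs_sub_le (lab z.2) (η z.1) (pol θ (h⁻¹ • (z.1 - x)))
        linarith
      nlinarith [abs_nonneg (psi h x a z.1), abs_nonneg (lab z.2 - pol θ (h⁻¹ • (z.1 - x)))]
    · rw [psi_off h x a z.1 hz]; simp
  have hf2b : ∀ a b z, |f2 a b z| ≤ if ‖z.1 - x‖ ≤ h then 1 + L else 0 := by
    intro a b z
    simp only [hf2]
    split_ifs with hz
    · rw [abs_mul]
      have e1 := abs_psi_le h hh x a z.1
      have e2 := abs_psi_le h hh x b z.1
      nlinarith [abs_nonneg (psi h x a z.1), abs_nonneg (psi h x b z.1)]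
    · rw [psi_off h x a z.1 hz]; simp
  have hcb : ∀ F : Euc d × Bool → ℝ, (∀ z, |F z| ≤ if ‖z.1 - x‖ ≤ h then 1 + L else 0) →
      ∀ z, |F z| ≤ 1 + L := by
    intro F hF z
    have := hF z
    split_ifs at this
    · exact this
    · linarith
  have hconc : ∀ F : Euc d × Bool → ℝ, Measurable F →
      (∀ z, |F z| ≤ if ‖z.1 - x‖ ≤ h then 1 + L else 0) →
      sampleLaw PX η n {ω | n * H * s ≤ |∑ i, F (ω i) - n * ∫ z, F z ∂P|} ≤
        ENNReal.ofReal (2 * Real.exp (-(n * H * s ^ 2 / (4 * (1 + L) ^ 2 * V)))) := by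
    intro F hFm hFb
    refine conc P F hFm (1 + L) V H s (by linarith) hV hsp hs2 (hcb F hFb) ?_ n
    refine (sq_joint PX η hη hη01 x h (1 + L) F hFm hFb).trans ?_
    rw [mul_assoc]
    exact mul_le_mul_of_nonneg_left hPV (sq_nonneg _)
  -- means
  have hmean1 : ∀ a, |∫ z, f1 a z ∂P| ≤ B * V * H := by
    intro a
    rw [hP, integral_jointLaw PX η hη hη01 (f1 a) (hf1m a) (1 + L) (hcb _ (hf1b a))]
    refine (int_ball PX x h B _ fun u => ?_).trans ?_
    · have : η u * f1 a (u, true) + (1 - η u) * f1 a (u, false) =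
          psi h x a u * (η u - pol θ (h⁻¹ • (u - x))) := by
        simp only [hf1, lab]; simp; ring
      rw [this]
      split_ifs with hu
      · rw [abs_mul]
        have e1 := abs_psi_le h hh x a u
        have e2 := hθ u hu
        nlinarith [abs_nonneg (psi h x a u), abs_nonneg (η u - pol θ (h⁻¹ • (u - x)))]
      · rw [psi_off h x a u hu]; simp
    · rw [mul_assoc]
      exact mul_le_mul_of_nonneg_left hPV hB
  have hmean2 : ∀ a b, ∫ z, f2 a b z ∂P = ∫ u, psi h x a u * psi h x b u ∂PX := by
    intro a b
    rw [hP, integral_jointLaw PX η hη hη01 (f2 a b) (hf2m a b) (1 + L) (hcb _ (hf2b a b))]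
    refine integral_congr_ae (Filter.Eventually.of_forall fun u => ?_)
    simp only [hf2]; ring
  have hpsim' : ∀ a : Fin d → Fin (l+1), Measurable fun u : Euc d => psi h x a u :=
    fun a => by
      have h1 : Measurable fun _ : Euc d => x := measurable_const
      have h2 : Measurable fun z : Euc d => z := measurable_id
      exact measurable_psi h a _ _ h1 h2
  have hIntg2 : ∀ a b : Fin d → Fin (l+1), Integrable (fun u => psi h x a u * psi h x b u) PX := by
    intro a b
    refine Integrable.of_bound ((hpsim' a).mul (hpsim' b)).aestronglyMeasurable 1
      (Filter.Eventually.of_forall fun u => ?_)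
    rw [Real.norm_eq_abs, abs_mul]
    exact mul_le_one₀ (abs_psi_le h hh x a u) (abs_nonneg _) (abs_psi_le h hh x b u)
  have hquad : ∀ v : (Fin d → Fin (l+1)) → ℝ, lam * H * ∑ a, v a ^ 2 ≤
      ∑ a, ∑ b, v a * v b * ∫ z, f2 a b z ∂P := by
    intro v
    refine (hcoer v).trans (le_of_eq ?_)
    have e1 : ∀ u, (closedBall x h).indicator (fun u => pol v (h⁻¹ • (u - x)) ^ 2) u =
        ∑ a, ∑ b, v a * v b * (psi h x a u * psi h x b u) := by
      intro u
      by_cases hu : ‖u - x‖ ≤ h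
      · rw [indicator_of_mem (by simpa [dist_eq_norm] using hu)]
        have e2 : pol v (h⁻¹ • (u - x)) = ∑ a, v a * psi h x a u := by
          unfold pol psi
          simp only [if_pos hu]
        rw [e2, sq, Finset.sum_mul_sum]
        refine Finset.sum_congr rfl fun a _ => Finset.sum_congr rfl fun b _ => by ring
      · rw [indicator_of_notMem (by simpa [dist_eq_norm] using hu)]
        symm
        refine Finset.sum_eq_zero fun a _ => Finset.sum_eq_zero fun b _ => ?_
        rw [psi_off h x a u hu]; ring
    simp only [e1]
    rw [integral_finsetSum _ fun a _ => integrable_finsetSum _ fun b _ => (hIntg2 a b).const_mul _]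
    refine Finset.sum_congr rfl fun a _ => ?_
    rw [integral_finsetSum _ fun b _ => (hIntg2 a b).const_mul _]
    refine Finset.sum_congr rfl fun b _ => ?_
    rw [integral_const_mul, hmean2]
  -- event inclusion
  set E1 : (Fin d → Fin (l+1)) → Set (Sample d n) := fun a =>
    {ω | n * H * s ≤ |∑ i, f1 a (ω i) - n * ∫ z, f1 a z ∂P|} with hE1
  set E2 : ((Fin d → Fin (l+1)) × (Fin d → Fin (l+1))) → Set (Sample d n) := fun c =>
    {ω | n * H * s ≤ |∑ i, f2 c.1 c.2 (ω i) - n * ∫ z, f2 c.1 c.2 z ∂P|} with hE2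
  have hsub : {ω : Sample d n | δ ≤ |est l h ω x - η x|} ⊆ (⋃ a, E1 a) ∪ ⋃ c, E2 c := by
    intro ω hω
    by_contra hcon
    have hω' : δ ≤ |est l h ω x - η x| := hω
    rw [mem_union, not_or, mem_iUnion, mem_iUnion, not_exists, not_exists] at hcon
    obtain ⟨hc1, hc2⟩ := hcon
    have hc1' : ∀ a, |∑ i, f1 a (ω i) - n * ∫ z, f1 a z ∂P| ≤ n * H * s := fun a =>
      (not_le.1 (hc1 a)).le
    have hc2' : ∀ a b, |∑ i, f2 a b (ω i) - n * ∫ z, f2 a b z ∂P| ≤ n * H * s := fun a b =>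
      (not_le.1 (hc2 (a, b))).le
    have hG : ∀ a b, gram l h ω x a b = ∑ i, f2 a b (ω i) := fun a b => rfl
    have hN : 0 < n * H := by positivity
    have hco : ∀ v : (Fin d → Fin (l+1)) → ℝ, lam / 2 * (n * H) * ∑ a, v a ^ 2 ≤
        ∑ a, ∑ b, v a * v b * gram l h ω x a b := by
      intro v
      have e1 := sum_abs_quad v (fun a b => ∑ i, f2 a b (ω i) - n * ∫ z, f2 a b z ∂P) _ hc2'
      have e2 := hquad v
      have e3 : ∑ a, ∑ b, v a * v b * gram l h ω x a b =
          ∑ a, ∑ b, v a * v b * (∑ i, f2 a b (ω i) - n * ∫ z, f2 a b z ∂P) +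
          n * ∑ a, ∑ b, v a * v b * ∫ z, f2 a b z ∂P := by
        rw [Finset.mul_sum, ← Finset.sum_add_distrib]
        refine Finset.sum_congr rfl fun a _ => ?_
        rw [Finset.mul_sum, ← Finset.sum_add_distrib]
        refine Finset.sum_congr rfl fun b _ => ?_
        rw [hG]; ring
      rw [e3]
      have e4 : s * p ≤ lam / 2 := by
        have : s ≤ lam / (8 * p) := hss0.trans hs0l
        rw [le_div_iff₀ (by positivity)] at this
        linarith
      have e5 := mul_le_mul_of_nonneg_left e2 hn0.le
      rw [← hp] at e1
      have hq : 0 ≤ ∑ a, v a ^ 2 := Finset.sum_nonneg fun a _ => sq_nonneg _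
      have e6 : (n * H * ∑ a, v a ^ 2) * (s * p) ≤ (n * H * ∑ a, v a ^ 2) * (lam / 2) :=
        mul_le_mul_of_nonneg_left e4 (by positivity)
      linarith
    have hS : ∀ a, |resp l h ω x a - ∑ b, gram l h ω x a b * θ b| ≤ (n * H) * (B * V + s) := by
      intro a
      have e1 : resp l h ω x a - ∑ b, gram l h ω x a b * θ b = ∑ i, f1 a (ω i) := by
        have e2 : ∑ b, gram l h ω x a b * θ b =
            ∑ i, psi h x a (ω i).1 * pol θ (h⁻¹ • ((ω i).1 - x)) := by
          simp only [psi_pol]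
          rw [Finset.sum_comm]
          refine Finset.sum_congr rfl fun b _ => ?_
          rw [hG, Finset.sum_mul]
        rw [e2]
        unfold resp
        rw [← Finset.sum_sub_distrib]
        refine Finset.sum_congr rfl fun i _ => ?_
        simp only [hf1]; ring
      rw [e1]
      have e3 := hc1' a
      have e4 := mul_le_mul_of_nonneg_left (hmean1 a) hn0.le
      have e5 : |∑ i, f1 a (ω i)| ≤ |∑ i, f1 a (ω i) - n * ∫ z, f1 a z ∂P| +
          |n * ∫ z, f1 a z ∂P| := by
        have := abs_add_le (∑ i, f1 a (ω i) - n * ∫ z, f1 a z ∂P) (n * ∫ z, f1 a z ∂P)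
        simpa using this
      rw [abs_mul (n : ℝ), abs_of_pos hn0] at e5
      linarith
    have hBV : 0 ≤ B * V := by positivity
    have herr := lin_err (gram l h ω x) (resp l h ω x) θ (n * H) (lam / 2) (B * V + s) hN
      (by positivity) (by positivity) hco hS 0
    rw [← hp, hθ0] at herr
    have herr2 : |rawEst l h ω x - η x| ≤ (B * V + s) * p / (lam / 2) := herr
    have h9 := (hω'.trans (est_err l h ω x (η x) (hη01 x))).trans herr2
    have h10 : (B * V + s) * p / (lam / 2) = B * V * (2 * p) / lam + s * (2 * p) / lam := by
      field_simp
    have h11 : s * (2 * p) / lam ≤ δ / 4 := by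
      rw [div_le_iff₀ hlam]
      rw [le_div_iff₀ (by positivity)] at hs0l
      rw [hs]
      nlinarith
    linarith
  refine (measure_mono hsub).trans ((measure_union_le _ _).trans
    ((add_le_add (measure_iUnion_fintype_le _ _) (measure_iUnion_fintype_le _ _)).trans ?_))
  set Z := 2 * Real.exp (-(n * H * s ^ 2 / (4 * (1 + L) ^ 2 * V))) with hZ
  have hZ0 : 0 ≤ Z := by positivity
  clear_value Z
  have b1 : ∑ a, sampleLaw PX η n (E1 a) ≤ ENNReal.ofReal (p * Z) := by
    refine (Finset.sum_le_card_nsmul _ _ (ENNReal.ofReal Z)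
      fun a _ => hconc _ (hf1m a) (hf1b a)).trans (le_of_eq ?_)
    rw [Finset.card_univ, nsmul_eq_mul, hp, ENNReal.ofReal_mul (by positivity),
      ENNReal.ofReal_natCast]
  have b2 : ∑ c, sampleLaw PX η n (E2 c) ≤ ENNReal.ofReal (p ^ 2 * Z) := by
    refine (Finset.sum_le_card_nsmul _ _ (ENNReal.ofReal Z)
      fun c _ => hconc _ (hf2m c.1 c.2) (hf2b c.1 c.2)).trans (le_of_eq ?_)
    rw [Finset.card_univ, nsmul_eq_mul, hp, ENNReal.ofReal_mul (by positivity),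
      Fintype.card_prod, ← sq, ← Nat.cast_pow, ENNReal.ofReal_natCast]
  refine (add_le_add b1 b2).trans (le_of_eq ?_)
  rw [← ENNReal.ofReal_add (by positivity) (by positivity)]
  congr 1; ring

lemma sampleLaw_le_one {d : ℕ} (PX : Measure (Euc d)) [IsProbabilityMeasure PX] (η : Euc d → ℝ)
    (hη : Measurable η) (hη01 : ∀ x, η x ∈ Icc (0 : ℝ) 1) (n : ℕ) (S : Set (Sample d n)) :
    sampleLaw PX η n S ≤ 1 := by
  have := isProb_jointLaw PX η hη hη01
  unfold sampleLaw
  exact prob_le_one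

lemma dens_lower {d : ℕ} (A : Set (Euc d)) (hA : MeasurableSet A) (μ : Euc d → ℝ) (μmin : ℝ)
    (hμA : ∀ x ∈ A, μmin ≤ μ x) (S : Set (Euc d)) (hS : MeasurableSet S) :
    ENNReal.ofReal μmin * volume (A ∩ S) ≤
      (volume.withDensity fun x => ENNReal.ofReal (μ x)) S := by
  rw [withDensity_apply _ hS]
  calc ENNReal.ofReal μmin * volume (A ∩ S)
      = ∫⁻ _ in A ∩ S, ENNReal.ofReal μmin := by rw [setLIntegral_const]
    _ ≤ ∫⁻ x in A ∩ S, ENNReal.ofReal (μ x) :=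
        setLIntegral_mono' (hA.inter hS) fun x hx => ENNReal.ofReal_le_ofReal (hμA x hx.1)
    _ ≤ _ := lintegral_mono_set inter_subset_right

lemma dens_upper {d : ℕ} (A : Set (Euc d)) (μ : Euc d → ℝ) (μmax : ℝ) (hmax : 0 ≤ μmax)
    (hμA : ∀ x ∈ A, μ x ≤ μmax) (hμ0 : ∀ x, x ∉ A → μ x = 0) (x : Euc d) (h : ℝ) (hh : 0 < h) :
    (volume.withDensity fun x => ENNReal.ofReal (μ x)).real (closedBall x h) ≤
      μmax * volume.real (closedBall (0 : Euc d) 1) * h ^ d := by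
  have h1 : (volume.withDensity fun x => ENNReal.ofReal (μ x)) (closedBall x h) ≤
      ENNReal.ofReal μmax * volume (closedBall x h) := by
    rw [withDensity_apply _ measurableSet_closedBall, ← setLIntegral_const]
    refine lintegral_mono fun y => ENNReal.ofReal_le_ofReal ?_
    by_cases hy : y ∈ A
    · exact hμA y hy
    · rw [hμ0 y hy]; exact hmax
  have h2 : volume.real (closedBall x h) = h ^ d * volume.real (closedBall (0 : Euc d) 1) := by
    have := Measure.addHaar_real_closedBall' (volume : Measure (Euc d)) x hh.le
    simpa using this
  have h3 := ENNReal.toReal_mono (ENNReal.mul_ne_top ENNReal.ofReal_ne_top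
    measure_closedBall_lt_top.ne) h1
  rw [ENNReal.toReal_mul, ENNReal.toReal_ofReal hmax] at h3
  change _ ≤ μmax * volume.real (closedBall x h) at h3
  rw [h2] at h3
  calc _ ≤ _ := h3
    _ = _ := by ring

lemma ae_mem_dens {d : ℕ} (A : Set (Euc d)) (hA : MeasurableSet A) (μ : Euc d → ℝ)
    (hμ0 : ∀ x, x ∉ A → μ x = 0) :
    ∀ᵐ x ∂(volume.withDensity fun x => ENNReal.ofReal (μ x)), x ∈ A := by
  rw [ae_iff]
  change (volume.withDensity fun x => ENNReal.ofReal (μ x)) Aᶜ = 0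
  rw [withDensity_apply _ hA.compl]
  rw [setLIntegral_congr_fun (g := fun _ => 0) hA.compl (fun x hx => by simp [hμ0 x hx])]
  simp

/-- The bandwidth. -/
def bw (d : ℕ) (β r0 : ℝ) (n : ℕ) : ℝ := min 1 r0 * (n : ℝ) ^ (-(1 / (2 * β + d)))

lemma bw_props (d : ℕ) (β r0 : ℝ) (hβ : 0 < β) (hr0 : 0 < r0) (n : ℕ) (hn : 1 ≤ n) :
    0 < bw d β r0 n ∧ bw d β r0 n ≤ 1 ∧ bw d β r0 n ≤ r0 ∧
    n * bw d β r0 n ^ d = (min 1 r0) ^ d * (n : ℝ) ^ (2 * β / (2 * β + d)) ∧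
    (n : ℝ) ^ (2 * β / (2 * β + d)) * (bw d β r0 n ^ β) ^ 2 ≤ 1 := by
  have hn1 : (1 : ℝ) ≤ n := by exact_mod_cast hn
  have hn0 : (0 : ℝ) < n := by linarith
  have hκ : 0 < min 1 r0 := lt_min one_pos hr0
  have hD : 0 < 2 * β + d := by positivity
  have hN : 0 < (n : ℝ) ^ (-(1 / (2 * β + d))) := Real.rpow_pos_of_pos hn0 _
  have hN1 : (n : ℝ) ^ (-(1 / (2 * β + d))) ≤ 1 :=
    Real.rpow_le_one_of_one_le_of_nonpos hn1 (by
      have : 0 < 1 / (2 * β + d) := by positivity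
      linarith)
  unfold bw
  refine ⟨by positivity, ?_, ?_, ?_, ?_⟩
  · exact mul_le_one₀ (min_le_left _ _) hN.le hN1
  · calc _ ≤ min 1 r0 * 1 := by gcongr
      _ ≤ r0 := by rw [mul_one]; exact min_le_right _ _
  · rw [mul_pow, ← Real.rpow_natCast ((n : ℝ) ^ _), ← Real.rpow_mul hn0.le]
    have : (n : ℝ) ^ (2 * β / (2 * β + d)) = n * (n : ℝ) ^ (-(1 / (2 * β + d)) * (d : ℝ)) := by
      nth_rewrite 2 [← Real.rpow_one (n : ℝ)]
      rw [← Real.rpow_add hn0]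
      congr 1
      field_simp
      ring
    rw [this]; ring
  · rw [Real.mul_rpow hκ.le hN.le, ← Real.rpow_mul hn0.le, mul_pow,
      ← Real.rpow_natCast ((n : ℝ) ^ _), ← Real.rpow_mul hn0.le]
    have h1 : (n : ℝ) ^ (2 * β / (2 * β + d)) *
        (n : ℝ) ^ (-(1 / (2 * β + d)) * β * ((2 : ℕ) : ℝ)) = 1 := by
      rw [← Real.rpow_add hn0]
      have h0 : 2 * β / (2 * β + d) + -(1 / (2 * β + d)) * β * ((2 : ℕ) : ℝ) = 0 := by
        push_cast
        ring
      rw [h0, Real.rpow_zero]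
    have h2 : (min 1 r0 ^ β) ^ 2 ≤ 1 :=
      pow_le_one₀ (by positivity) (Real.rpow_le_one hκ.le (min_le_left _ _) hβ.le)
    calc _ = (min 1 r0 ^ β) ^ 2 * ((n : ℝ) ^ (2 * β / (2 * β + d)) *
        (n : ℝ) ^ (-(1 / (2 * β + d)) * β * ((2 : ℕ) : ℝ))) := by ring
      _ ≤ 1 := by rw [h1, mul_one]; exact h2

/-- Theorem 3.2. For the class of distributions with Hölder regression
function and marginal satisfying the strong density assumption, there is an estimator
(with values in `[0,1]`) satisfying a uniform exponential deviation inequality with rate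
`n^{2β/(2β+d)}`. -/
theorem stmt1 (d : ℕ) (hd : 1 ≤ d) (β L c0 r0 μmin μmax : ℝ) (hβ : 0 < β) (hL : 0 < L)
    (hc0 : 0 < c0) (hr0 : 0 < r0) (hμmin : 0 < μmin) (hμ : μmin ≤ μmax)
    (K : Set (Euc d)) (hK : IsCompact K) :
    ∃ C1 : ℝ, 0 < C1 ∧ ∃ C2 : ℝ, 0 < C2 ∧
      ∃ hatη : (n : ℕ) → Sample d n → Euc d → ℝ,
        (∀ n, Measurable (Function.uncurry (hatη n))) ∧
        (∀ n ω x, hatη n ω x ∈ Icc (0 : ℝ) 1) ∧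
        ∀ (PX : Measure (Euc d)) (η : Euc d → ℝ),
          IsProbabilityMeasure PX → Measurable η → (∀ x, η x ∈ Icc (0 : ℝ) 1) →
          HolderClass β L η → StrongDensity PX c0 r0 μmin μmax K →
          ∀ n, 1 ≤ n → ∀ δ : ℝ, 0 < δ →
            ∀ᵐ x ∂PX,
              sampleLaw PX η n {ω | δ ≤ |hatη n ω x - η x|} ≤
                ENNReal.ofReal
                  (C1 * Real.exp (-C2 * (n : ℝ) ^ (2 * β / (2 * β + d)) * δ ^ 2)) := by
  set l := ⌈β⌉₊ - 1 with hl
  obtain ⟨lam, hlam, hco⟩ := coer d l c0 μmin hc0 hμmin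
  have hμmax : 0 < μmax := hμmin.trans_le hμ
  set V : ℝ := max 1 (μmax * volume.real (closedBall (0 : Euc d) 1)) with hVdef
  have hV1 : 1 ≤ V := le_max_left _ _
  have hV0 : 0 < V := by linarith
  obtain ⟨p, hp⟩ : ∃ p : ℝ, p = Fintype.card (Fin d → Fin (l+1)) := ⟨_, rfl⟩
  have hp0 : 0 < p := by rw [hp]; exact_mod_cast Fintype.card_pos
  set s0 : ℝ := min 1 (lam / (8 * p)) with hs0def
  have hs0 : 0 < s0 := lt_min one_pos (by positivity)
  set κ : ℝ := min 1 r0 with hκdef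
  have hκ : 0 < κ := lt_min one_pos hr0
  set G : ℝ := L * V * (8 * p) / lam with hG
  have hG0 : 0 < G := by positivity
  set C2 : ℝ := κ ^ d * s0 ^ 2 / (4 * (1 + L) ^ 2 * V) with hC2
  have hC20 : 0 < C2 := by positivity
  clear_value l V s0 κ
  refine ⟨max (2 * (p + p ^ 2)) (Real.exp (C2 * G ^ 2)), lt_max_of_lt_left (by positivity),
    C2, hC20, fun n ω x => est l (bw d β r0 n) ω x, fun n => measurable_est l _ n,
    fun n ω x => est_mem l _ ω x, ?_⟩
  intro PX η hPX hη hη01 hH hSD n hn δ hδ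
  obtain ⟨A, hAc, -, hreg, μ, hμm, hμA, hμ0, hPXeq⟩ := hSD
  have hA := hAc.measurableSet
  obtain ⟨hh, hh1, hhr, hnh, hnb⟩ := bw_props d β r0 hβ hr0 n hn
  have hae : ∀ᵐ x ∂PX, x ∈ A := by rw [hPXeq]; exact ae_mem_dens A hA μ hμ0
  filter_upwards [hae] with x hx
  rw [← hκdef] at hnh
  set h := bw d β r0 n with hhdef
  set N : ℝ := (n : ℝ) ^ (2 * β / (2 * β + d)) with hN
  have hN0 : 0 ≤ N := by positivity
  clear_value h N
  have hhβ0 : 0 ≤ h ^ β := by positivity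
  have hhβ1 : h ^ β ≤ 1 := Real.rpow_le_one hh.le hh1 hβ.le
  rcases lt_or_ge 1 δ with hδ1 | hδ1
  · have : {ω : Sample d n | δ ≤ |est l h ω x - η x|} = ∅ := by
      ext ω
      simp only [mem_ofPred_eq, mem_empty_iff_false, iff_false, not_le]
      have h1 := est_mem l h ω x
      have h2 := hη01 x
      refine lt_of_le_of_lt ?_ hδ1
      rw [abs_le]
      constructor <;> linarith [h1.1, h1.2, h2.1, h2.2]
    rw [this, measure_empty]
    simp
  rcases lt_or_ge δ (G * h ^ β) with hc | hc
  · refine (sampleLaw_le_one PX η hη hη01 n _).trans ?_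
    rw [ENNReal.one_le_ofReal]
    have h1 : N * δ ^ 2 ≤ G ^ 2 := by
      calc N * δ ^ 2 ≤ N * (G * h ^ β) ^ 2 := by gcongr
        _ = G ^ 2 * (N * (h ^ β) ^ 2) := by ring
        _ ≤ G ^ 2 * 1 := by gcongr
        _ = G ^ 2 := mul_one _
    calc (1 : ℝ) ≤ Real.exp (C2 * G ^ 2 + -C2 * N * δ ^ 2) :=
          Real.one_le_exp (by nlinarith)
      _ = Real.exp (C2 * G ^ 2) * Real.exp (-C2 * N * δ ^ 2) := Real.exp_add _ _
      _ ≤ _ := by gcongr; exact le_max_right _ _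
  · obtain ⟨θ, hθ⟩ := taylor_pol η l x h hh
    have hHol : ∀ u, |η u - pol θ (h⁻¹ • (u - x))| ≤ L * ‖u - x‖ ^ β := by
      intro u
      rw [← hθ u, hl]
      exact hH.2 x u
    have hθ0 : θ 0 = η x := by
      have h1 := hHol x
      rw [sub_self, smul_zero, pol_zero, norm_zero, Real.zero_rpow hβ.ne', mul_zero] at h1
      have h2 := abs_nonpos_iff.1 h1
      linarith
    have hmin : ∀ S, MeasurableSet S → ENNReal.ofReal μmin * volume (A ∩ S) ≤ PX S := by
      intro S hS
      rw [hPXeq]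
      exact dens_lower A hA μ μmin (fun x hx => (hμA x hx).1) S hS
    have hPV : PX.real (closedBall x h) ≤ V * h ^ d := by
      have h1 := dens_upper A μ μmax hμmax.le (fun x hx => (hμA x hx).2) hμ0 x h hh
      rw [← hPXeq] at h1
      refine h1.trans ?_
      gcongr
      rw [hVdef]; exact le_max_right _ _
    have hcore := core hn PX η hη hη01 x h hh L (L * h ^ β) hL (by positivity)
      (by nlinarith) θ
      (fun u hu => (hHol u).trans (by gcongr)) hθ0 V hV1 hPV lam hlam
      (hco A PX h x hPX hh hmin (hreg x hx h hh hhr)) p hp δ hδ hδ1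
      (by
        have : L * h ^ β * V * (2 * p) / lam = G * h ^ β / 4 := by rw [hG]; ring
        rw [this]; linarith)
      s0 hs0 (by rw [hs0def]; exact min_le_left _ _) (by rw [hs0def]; exact min_le_right _ _)
    refine hcore.trans (ENNReal.ofReal_le_ofReal ?_)
    have he : -(n * h ^ d * (s0 * δ) ^ 2 / (4 * (1 + L) ^ 2 * V)) = -C2 * N * δ ^ 2 := by
      rw [hnh, hC2]; ring
    rw [he]
    calc _ = (2 * (p + p ^ 2)) * Real.exp (-C2 * N * δ ^ 2) := by ring
      _ ≤ _ := by gcongr; exact le_max_left _ _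

end
end
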